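/- arXiv:1211.1559 — 3 statements merged into one kernel-verified Lean document; each statement's English description precedes it below -/
import Mathlib

section
/- Let X be a Banach space of type p with 1 < p ≤ 2, let S : l_1 → X be a bounded linear operator, and let D_σ : l_1 → l_1 be the diagonal operator induced by a non-increasing, non-negative sequence σ = (σ_n). Let T = S D_σ. If 0 < r < p' and 0 < s ≤ ∞, then (σ_{2^{n−1}})_n ∈ l_{r,s} implies (e_n(T))_n ∈ l_{p',s,α} with α = 1/s + 1/p' − 1/r (where 1/s = 0 when s = ∞). -/
open MeasureTheory

/-- The `n`-th entropy number of a subset `A` of a pseudometric space. -/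
noncomputable def entropyNum {X : Type*} [PseudoMetricSpace X] (A : Set X) (n : ℕ) : ℝ :=
  sInf {ε : ℝ | 0 ≤ ε ∧ ∃ T : Finset X, T.card ≤ n ∧ A ⊆ ⋃ x ∈ T, Metric.closedBall x ε}

/-- The `n`-th dyadic entropy number of a subset `A`. -/
noncomputable def dyadEntropyNum {X : Type*} [PseudoMetricSpace X] (A : Set X) (n : ℕ) : ℝ :=
  entropyNum A (2 ^ (n - 1))

/-- The `n`-th entropy number of a bounded linear operator. -/
noncomputable def opEntropyNum {X Y : Type*} [SeminormedAddCommGroup X] [SeminormedAddCommGroup Y]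
    [NormedSpace ℝ X] [NormedSpace ℝ Y] (T : X →L[ℝ] Y) (n : ℕ) : ℝ :=
  entropyNum (T '' Metric.closedBall 0 1) n

/-- The `n`-th dyadic entropy number of a bounded linear operator. -/
noncomputable def opDyadEntropyNum {X Y : Type*} [SeminormedAddCommGroup X]
    [SeminormedAddCommGroup Y] [NormedSpace ℝ X] [NormedSpace ℝ Y]
    (T : X →L[ℝ] Y) (n : ℕ) : ℝ :=
  opEntropyNum T (2 ^ (n - 1))

/-- The absolutely convex hull of a set: all finite sums `∑ λ i • a i` with `∑ |λ i| ≤ 1`. -/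
def absConvHull {X : Type*} [AddCommGroup X] [Module ℝ X] (A : Set X) : Set X :=
  {x | ∃ (n : ℕ) (a : Fin n → X) (lam : Fin n → ℝ),
    (∀ i, a i ∈ A) ∧ (∑ i, |lam i|) ≤ 1 ∧ x = ∑ i, lam i • a i}

/-- The `i`-th Rademacher function. -/
noncomputable def rademacherFn (i : ℕ) (t : ℝ) : ℝ :=
  Real.sign (Real.sin (2 ^ i * Real.pi * t))

/-- `X` is of type `p` with constant `ρ`. -/
def IsTypePWith (X : Type*) [SeminormedAddCommGroup X] [NormedSpace ℝ X] (p ρ : ℝ) : Prop :=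
  ∀ (k : ℕ) (x : Fin k → X),
    (∫ t in (0:ℝ)..1, ‖∑ i : Fin k, rademacherFn (i.1 + 1) t • x i‖) ≤
      ρ * (∑ i : Fin k, ‖x i‖ ^ p) ^ (1 / p)

/-- `X` is a Banach space of type `p`. -/
def IsTypeP (X : Type*) [SeminormedAddCommGroup X] [NormedSpace ℝ X] (p : ℝ) : Prop :=
  ∃ ρ > 0, IsTypePWith X p ρ

/-- Membership in the generalized Lorentz sequence space `l_{r,s,α}`, `0 < s < ∞`:
`∑_{n ≥ 1} (log₂(n+1))^{-αs} n^{s/r-1} ξ_n^s < ∞`. -/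
def MemLorentz (r s α : ℝ) (ξ : ℕ → ℝ) : Prop :=
  Summable fun n : ℕ =>
    (Real.logb 2 ((n : ℝ) + 2)) ^ (-(α * s)) * ((n : ℝ) + 1) ^ (s / r - 1) * ξ (n + 1) ^ s

/-- Membership in the generalized Lorentz sequence space `l_{r,∞,α}`:
`sup_{n ≥ 1} (log₂(n+1))^{-α} n^{1/r} ξ_n < ∞`. -/
def MemLorentzTop (r α : ℝ) (ξ : ℕ → ℝ) : Prop :=
  ∃ C : ℝ, ∀ n : ℕ, 1 ≤ n →
    (Real.logb 2 ((n : ℝ) + 1)) ^ (-α) * (n : ℝ) ^ (1 / r) * ξ n ≤ C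

/-- The `n`-th Kolmogorov number of a bounded linear operator. -/
noncomputable def kolmogorovNum {X Y : Type*} [SeminormedAddCommGroup X] [NormedSpace ℝ X]
    [NormedAddCommGroup Y] [NormedSpace ℝ Y] (T : X →L[ℝ] Y) (n : ℕ) : ℝ :=
  sInf {c : ℝ | ∃ F : Submodule ℝ Y, Module.rank ℝ F < (n : Cardinal) ∧
    ∀ x ∈ Metric.closedBall (0 : X) 1, Metric.infDist (T x) (F : Set Y) ≤ c}

/-- The `l`-norm of an operator from a finite-dimensional Euclidean space. -/
noncomputable def ellNormFin {Y : Type*} [SeminormedAddCommGroup Y] [NormedSpace ℝ Y] {n : ℕ}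
    (S : EuclideanSpace ℝ (Fin n) →L[ℝ] Y) : ℝ :=
  (∫ x : Fin n → ℝ, ‖S ((WithLp.equiv 2 (Fin n → ℝ)).symm x)‖ ^ 2
      ∂(Measure.pi fun _ : Fin n => ProbabilityTheory.gaussianReal 0 1)) ^ ((1 : ℝ) / 2)

/-- The `l`-norm of an operator between Banach spaces. -/
noncomputable def ellNorm {X Y : Type*} [SeminormedAddCommGroup X] [NormedSpace ℝ X]
    [SeminormedAddCommGroup Y] [NormedSpace ℝ Y] (T : X →L[ℝ] Y) : ℝ :=
  sSup {c : ℝ | ∃ (n : ℕ) (A : EuclideanSpace ℝ (Fin n) →L[ℝ] X),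
    ‖A‖ ≤ 1 ∧ c = ellNormFin (T.comp A)}

/-- The `n`-th approximation number of `T` with respect to the `l`-norm. -/
noncomputable def approxNumEll {X Y : Type*} [SeminormedAddCommGroup X] [NormedSpace ℝ X]
    [SeminormedAddCommGroup Y] [NormedSpace ℝ Y] (T : X →L[ℝ] Y) (n : ℕ) : ℝ :=
  sInf {c : ℝ | ∃ A : X →L[ℝ] Y,
    Module.rank ℝ (LinearMap.range (A : X →ₗ[ℝ] Y)) < (n : Cardinal) ∧ c = ellNorm (T - A)}

lemma measurable_rademacherFn (i : ℕ) : Measurable (rademacherFn i) := by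
  have h : Measurable Real.sign := by
    unfold Real.sign
    exact Measurable.ite measurableSet_Iio measurable_const
      (Measurable.ite measurableSet_Ioi measurable_const measurable_const)
  unfold rademacherFn
  exact h.comp (by fun_prop)

lemma rademacherFn_trichotomy (i : ℕ) (t : ℝ) :
    rademacherFn i t = -1 ∨ rademacherFn i t = 0 ∨ rademacherFn i t = 1 :=
  Real.sign_apply_eq _

lemma countable_rademacherFn_eq_zero (i : ℕ) : {t : ℝ | rademacherFn i t = 0}.Countable := by
  refine (Set.countable_range fun n : ℤ => (n : ℝ) / 2 ^ i).mono ?_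
  intro t ht
  have h0 : Real.sin (2 ^ i * Real.pi * t) = 0 := Real.sign_eq_zero_iff.mp ht
  obtain ⟨n, hn⟩ := Real.sin_eq_zero_iff.mp h0
  refine ⟨n, ?_⟩
  have hpi := Real.pi_ne_zero
  have : (n : ℝ) = 2 ^ i * t := by
    apply mul_right_cancel₀ hpi
    rw [hn]; ring
  simp only [this]
  field_simp

/-- In a space of type `p`, some choice of signs is as good as the Rademacher average. -/
lemma IsTypePWith.exists_signs {X : Type*} [NormedAddCommGroup X] [NormedSpace ℝ X] {p ρ : ℝ}
    (hX : IsTypePWith X p ρ) (k : ℕ) (x : Fin k → X) :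
    ∃ ε : Fin k → ℝ, (∀ i, ε i = 1 ∨ ε i = -1) ∧
      ‖∑ i, ε i • x i‖ ≤ ρ * (∑ i, ‖x i‖ ^ p) ^ (1 / p) := by
  set f : ℝ → ℝ := fun t => ‖∑ i : Fin k, rademacherFn (i.1 + 1) t • x i‖ with hf
  set μ : Measure ℝ := volume.restrict (Set.Ioc 0 1) with hμ
  have : IsProbabilityMeasure μ := ⟨by simp [hμ]⟩
  have hint : Integrable f μ := by
    refine Integrable.of_bound (C := ∑ i, ‖x i‖) ?_ ?_
    · refine (StronglyMeasurable.norm ?_).aestronglyMeasurable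
      refine Finset.stronglyMeasurable_fun_sum _ fun i _ => ?_
      exact (measurable_rademacherFn _).stronglyMeasurable.smul_const _
    · refine Filter.Eventually.of_forall fun t => ?_
      rw [hf, norm_norm]
      refine (norm_sum_le _ _).trans (Finset.sum_le_sum fun i _ => ?_)
      rw [norm_smul]
      refine mul_le_of_le_one_left (norm_nonneg _) ?_
      rcases rademacherFn_trichotomy (i.1 + 1) t with h | h | h <;> simp [h]
  have hnull : μ (⋃ i : Fin k, {t : ℝ | rademacherFn (i.1 + 1) t = 0}) = 0 :=
    Measure.restrict_le_self.absolutelyContinuous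
      ((Set.countable_iUnion fun i : Fin k =>
        countable_rademacherFn_eq_zero (i.1 + 1)).measure_zero volume)
  obtain ⟨t, ht, hle⟩ := exists_notMem_null_le_integral hint hnull
  refine ⟨fun i => rademacherFn (i.1 + 1) t, fun i => ?_, hle.trans ?_⟩
  · have hi : rademacherFn (i.1 + 1) t ≠ 0 := fun h => ht (Set.mem_iUnion.mpr ⟨i, h⟩)
    rcases rademacherFn_trichotomy (i.1 + 1) t with h | h | h
    · exact Or.inr h
    · exact absurd h hi
    · exact Or.inl h
  · have := hX k x
    rwa [intervalIntegral.integral_of_le zero_le_one] at this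

/-- A multiset in a space of type `p` contains a submultiset of at most half its cardinality whose
sum is close to half the sum. -/
lemma IsTypePWith.exists_half {X : Type*} [NormedAddCommGroup X] [NormedSpace ℝ X] {p ρ : ℝ}
    (hX : IsTypePWith X p ρ) (hp : 0 < p) (hρ : 0 ≤ ρ) {a : ℝ} (ha : 0 ≤ a) (s : Multiset X)
    (hs : ∀ v ∈ s, ‖v‖ ≤ a) :
    ∃ t ≤ s, 2 * t.card ≤ s.card ∧
      ‖s.sum - (2 : ℝ) • t.sum‖ ≤ ρ * (s.card : ℝ) ^ (1 / p) * a := by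
  classical
  obtain ⟨l, rfl⟩ : ∃ l : List X, (l : Multiset X) = s := Quot.exists_rep s
  set z : Fin l.length → X := l.get with hz
  have hlz : (l : Multiset X) = Finset.univ.val.map z := by
    rw [Fin.univ_val_map, hz, List.ofFn_get]
  obtain ⟨ε, hε, hle⟩ := hX.exists_signs l.length z
  have hbound : ρ * (∑ i, ‖z i‖ ^ p) ^ (1 / p) ≤ ρ * (l.length : ℝ) ^ (1 / p) * a := by
    rw [mul_assoc]
    refine mul_le_mul_of_nonneg_left ?_ hρ
    have h1 : ∑ i, ‖z i‖ ^ p ≤ l.length * a ^ p := by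
      calc ∑ i, ‖z i‖ ^ p ≤ ∑ _i : Fin l.length, a ^ p :=
            Finset.sum_le_sum fun i _ => Real.rpow_le_rpow (norm_nonneg _)
              (hs _ (List.get_mem l i)) hp.le
        _ = l.length * a ^ p := by simp
    calc (∑ i, ‖z i‖ ^ p) ^ (1 / p) ≤ (l.length * a ^ p) ^ (1 / p) :=
          Real.rpow_le_rpow (by positivity) h1 (by positivity)
      _ = (l.length : ℝ) ^ (1 / p) * a := by
          rw [Real.mul_rpow (by positivity) (by positivity), ← Real.rpow_mul ha,
            mul_one_div_cancel hp.ne', Real.rpow_one]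
  set P : Finset (Fin l.length) := Finset.univ.filter fun i => ε i = 1 with hP
  have hsum : ∑ i, z i = ∑ i ∈ P, z i + ∑ i ∈ Pᶜ, z i := (Finset.sum_add_sum_compl P z).symm
  have hdiff : ∑ i, ε i • z i = ∑ i ∈ P, z i - ∑ i ∈ Pᶜ, z i := by
    rw [← Finset.sum_add_sum_compl P, sub_eq_add_neg, ← Finset.sum_neg_distrib]
    congr 1
    · refine Finset.sum_congr rfl fun i hi => ?_
      rw [(Finset.mem_filter.mp hi).2, one_smul]
    · refine Finset.sum_congr rfl fun i hi => ?_
      have : ε i ≠ 1 := by simpa [hP] using hi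
      rw [(hε i).resolve_left this, neg_smul, one_smul]
  have hcard : P.card + Pᶜ.card = l.length := by
    rw [Finset.card_add_card_compl, Fintype.card_fin]
  have hls : (l : Multiset X).sum = ∑ i, z i := by rw [hlz]; rfl
  have key : ∀ Q : Finset (Fin l.length), 2 * Q.card ≤ l.length →
      ‖∑ i, z i - (2 : ℝ) • ∑ i ∈ Q, z i‖ ≤ ρ * (∑ i, ‖z i‖ ^ p) ^ (1 / p) →
      ∃ t ≤ (l : Multiset X), 2 * t.card ≤ (l : Multiset X).card ∧
      ‖(l : Multiset X).sum - (2 : ℝ) • t.sum‖ ≤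
        ρ * ((l : Multiset X).card : ℝ) ^ (1 / p) * a := by
    intro Q hQ hn
    refine ⟨Q.val.map z, ?_, by simpa using hQ, ?_⟩
    · rw [hlz]
      exact Multiset.map_le_map (Finset.val_le_iff.mpr (Finset.subset_univ Q))
    · rw [hls, Multiset.coe_card]
      exact hn.trans hbound
  rcases le_total P.card Pᶜ.card with h | h
  · refine key P (by omega) ?_
    rw [← norm_neg]
    refine le_of_eq_of_le (congrArg norm ?_) hle
    rw [hdiff, hsum, two_smul]; abel
  · refine key Pᶜ (by omega) ?_
    refine le_of_eq_of_le (congrArg norm ?_) hle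
    rw [hdiff, hsum, two_smul]; abel

/-- Iterated halving: an average of `2 ^ M * h` vectors is close to an average of `h` of them. -/
lemma IsTypePWith.exists_sparse {X : Type*} [NormedAddCommGroup X] [NormedSpace ℝ X] {p ρ : ℝ}
    (hX : IsTypePWith X p ρ) (hp : 1 < p) (hρ : 0 ≤ ρ) {a : ℝ} (ha : 0 ≤ a) {h : ℕ} (hh : 0 < h)
    (M : ℕ) (s : Multiset X) (hs : ∀ v ∈ s, ‖v‖ ≤ a) (hc : s.card ≤ 2 ^ M * h) :
    ∃ t ≤ s, t.card ≤ h ∧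
      ‖((2 : ℝ) ^ M * h)⁻¹ • s.sum - (h : ℝ)⁻¹ • t.sum‖ ≤
        ρ * a * (h : ℝ) ^ (-(1 - 1 / p)) *
          ∑ l ∈ Finset.range M, ((2 : ℝ) ^ (-(1 - 1 / p))) ^ (l + 1) := by
  have hp0 : 0 < p := by linarith
  have hh' : (0 : ℝ) < h := by exact_mod_cast hh
  induction M generalizing s with
  | zero =>
    refine ⟨s, le_rfl, by simpa using hc, ?_⟩
    simp
  | succ M ih =>
    obtain ⟨u, hus, huc, hun⟩ := hX.exists_half hp0 hρ ha s hs
    obtain ⟨t, htu, htc, htn⟩ := ih u (fun v hv => hs v (Multiset.mem_of_le hus hv))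
      (by rw [pow_succ, mul_right_comm] at hc; omega)
    refine ⟨t, htu.trans hus, htc, ?_⟩
    rw [Finset.sum_range_succ, mul_add]
    have hsplit : ((2 : ℝ) ^ (M + 1) * h)⁻¹ • s.sum - (h : ℝ)⁻¹ • t.sum =
        (((2 : ℝ) ^ M * h)⁻¹ • u.sum - (h : ℝ)⁻¹ • t.sum) +
          ((2 : ℝ) ^ (M + 1) * h)⁻¹ • (s.sum - (2 : ℝ) • u.sum) := by
      rw [smul_sub, smul_smul]
      have : ((2 : ℝ) ^ (M + 1) * h)⁻¹ * 2 = ((2 : ℝ) ^ M * h)⁻¹ := by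
        rw [pow_succ]; field_simp
      rw [this]; abel
    rw [hsplit]
    refine (norm_add_le _ _).trans (add_le_add htn ?_)
    rw [norm_smul, Real.norm_of_nonneg (by positivity)]
    have hcard : (s.card : ℝ) ≤ (2 : ℝ) ^ (M + 1) * h := by exact_mod_cast hc
    set H : ℝ := (2 : ℝ) ^ (M + 1) * h with hH
    have hHpos : 0 < H := by positivity
    calc H⁻¹ * ‖s.sum - (2 : ℝ) • u.sum‖ ≤ H⁻¹ * (ρ * H ^ (1 / p) * a) := by
          refine mul_le_mul_of_nonneg_left (hun.trans ?_) (by positivity)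
          gcongr
      _ = ρ * a * H ^ (-(1 - 1 / p)) := by
          have : H ^ (-(1 - 1 / p)) = H⁻¹ * H ^ (1 / p) := by
            rw [← Real.rpow_neg_one, ← Real.rpow_add hHpos]; ring_nf
          rw [this]; ring
      _ = ρ * a * (h : ℝ) ^ (-(1 - 1 / p)) * ((2 : ℝ) ^ (-(1 - 1 / p))) ^ (M + 1) := by
          rw [hH, Real.mul_rpow (by positivity) hh'.le, ← Real.rpow_natCast_mul (by norm_num),
            mul_comm ((M + 1 : ℕ) : ℝ), Real.rpow_mul_natCast (by norm_num)]
          ring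

open scoped Pointwise in
/-- Maurey's covering lemma in spaces of type `p`. -/
lemma IsTypePWith.exists_cover {X : Type*} [NormedAddCommGroup X] [NormedSpace ℝ X] {p ρ : ℝ}
    (hX : IsTypePWith X p ρ) (hp : 1 < p) (hρ : 0 ≤ ρ) :
    ∃ C : ℝ, 0 < C ∧ ∀ (K : Finset ℕ) (y : ℕ → X) (a : ℝ), 0 ≤ a → (∀ k ∈ K, ‖y k‖ ≤ a) →
      ∀ h : ℕ, ∃ T : Finset X, T.card ≤ (2 * K.card + 1) ^ h ∧
        ∀ c : ℕ → ℝ, ∑ k ∈ K, |c k| ≤ 1 →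
          ∃ t ∈ T, ‖∑ k ∈ K, c k • y k - t‖ ≤ C * a * ((h : ℝ) + 1) ^ (-(1 - 1 / p)) := by
  classical
  have ht0 : 0 < 1 - 1 / p := by
    rw [sub_pos, div_lt_one (by linarith)]; exact hp
  have ht1 : 1 - 1 / p ≤ 1 := by
    have : 0 < 1 / p := by positivity
    linarith
  set τ : ℝ := 1 - 1 / p with hτ
  set x : ℝ := (2 : ℝ) ^ (-τ) with hx
  have hx0 : 0 < x := by positivity
  have hx1 : x < 1 := Real.rpow_lt_one_of_one_lt_of_neg (by norm_num) (by linarith)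
  have hgeom : 0 < (1 - x)⁻¹ := inv_pos.mpr (by linarith)
  refine ⟨2 * (1 + ρ * (1 - x)⁻¹), by positivity, fun K y a ha hy h => ?_⟩
  set W : Finset X := insert 0 (K.image y ∪ K.image fun k => -y k) with hW
  have hWcard : W.card ≤ 2 * K.card + 1 := by
    refine (Finset.card_insert_le _ _).trans (Nat.add_le_add_right ?_ 1)
    refine (Finset.card_union_le _ _).trans ?_
    have h1 := Finset.card_image_le (s := K) (f := y)
    have h2 := Finset.card_image_le (s := K) (f := fun k => -y k)
    omega
  have hmem : ∀ (s : Multiset X) (n : ℕ), (∀ v ∈ s, v ∈ W) → s.card ≤ n → s.sum ∈ n • W := by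
    intro s
    induction s using Multiset.induction with
    | empty =>
      intro n _ _
      have h0 : (0 : X) ∈ W := Finset.mem_insert_self _ _
      simpa using Finset.nsmul_mem_nsmul (n := n) h0
    | cons v s ih =>
      intro n hv hn
      rw [Multiset.card_cons] at hn
      obtain ⟨n, rfl⟩ : ∃ m, n = m + 1 := ⟨n - 1, by omega⟩
      rw [Multiset.sum_cons, succ_nsmul, add_comm v]
      exact Finset.add_mem_add (ih n (fun w hw => hv w (Multiset.mem_cons_of_mem hw)) (by omega))
        (hv v (Multiset.mem_cons_self v s))
  refine ⟨(h • W).image fun v => (h : ℝ)⁻¹ • v, ?_, fun c hc => ?_⟩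
  · exact Finset.card_image_le.trans
      (Finset.card_nsmul_le.trans (Nat.pow_le_pow_left hWcard h))
  have hC1 : 1 ≤ 1 + ρ * (1 - x)⁻¹ := by
    have : 0 ≤ ρ * (1 - x)⁻¹ := by positivity
    linarith
  rcases Nat.eq_zero_or_pos h with rfl | hh
  · refine ⟨0, by simp, ?_⟩
    have h1 : ‖∑ k ∈ K, c k • y k‖ ≤ a := by
      calc ‖∑ k ∈ K, c k • y k‖ ≤ ∑ k ∈ K, |c k| * a := by
            refine norm_sum_le_of_le _ fun k hk => ?_
            rw [norm_smul, Real.norm_eq_abs]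
            exact mul_le_mul_of_nonneg_left (hy k hk) (abs_nonneg _)
        _ = (∑ k ∈ K, |c k|) * a := by rw [Finset.sum_mul]
        _ ≤ a := mul_le_of_le_one_left ha hc
    rw [sub_zero]
    simp only [Nat.cast_zero, zero_add, Real.one_rpow, mul_one]
    nlinarith
  have hh' : (0 : ℝ) < h := by exact_mod_cast hh
  have hh1 : (1 : ℝ) ≤ h := by exact_mod_cast hh
  set M := K.card with hM
  set H : ℕ := 2 ^ M * h with hH
  have hHR : (H : ℝ) = 2 ^ M * h := by rw [hH]; push_cast; rfl
  have hHpos : (0 : ℝ) < H := by rw [hHR]; positivity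
  set v : ℕ → X := fun k => if 0 ≤ c k then y k else -y k with hv
  have hvW : ∀ k ∈ K, v k ∈ W := by
    intro k hk
    simp only [hv, hW]
    split_ifs
    · exact Finset.mem_insert_of_mem (Finset.mem_union_left _ (Finset.mem_image_of_mem _ hk))
    · exact Finset.mem_insert_of_mem
        (Finset.mem_union_right _ (Finset.mem_image_of_mem (fun k => -y k) hk))
  have hvn : ∀ k ∈ K, ‖v k‖ ≤ a := by
    intro k hk
    simp only [hv]
    split_ifs
    · exact hy k hk
    · rw [norm_neg]; exact hy k hk
  have hcv : ∀ k, c k • y k = |c k| • v k := by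
    intro k
    simp only [hv]
    split_ifs with h0
    · rw [abs_of_nonneg h0]
    · rw [abs_of_neg (not_le.mp h0), smul_neg, neg_smul, neg_neg]
  set n : ℕ → ℕ := fun k => ⌊|c k| * H⌋₊ with hn
  have hn_le : ∀ k, (n k : ℝ) ≤ |c k| * H := fun k => Nat.floor_le (by positivity)
  have hn_lt : ∀ k, |c k| * H < n k + 1 := fun k => Nat.lt_floor_add_one _
  set s : Multiset X := ∑ k ∈ K, Multiset.replicate (n k) (v k) with hs
  have hsv : ∀ w ∈ s, ∃ k ∈ K, w = v k := by
    intro w hw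
    obtain ⟨k, hk, hwk⟩ := Multiset.mem_sum.mp hw
    exact ⟨k, hk, Multiset.eq_of_mem_replicate hwk⟩
  have hssum : s.sum = ∑ k ∈ K, (n k : ℝ) • v k := by
    rw [hs, ← Multiset.coe_sumAddMonoidHom, map_sum]
    refine Finset.sum_congr rfl fun k _ => ?_
    rw [Multiset.coe_sumAddMonoidHom, Multiset.sum_replicate, Nat.cast_smul_eq_nsmul]
  have hscard : s.card ≤ H := by
    have h1 : s.card = ∑ k ∈ K, n k := by
      rw [hs, Multiset.card_sum]
      simp
    rw [h1]
    have : (∑ k ∈ K, (n k : ℝ)) ≤ H := by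
      calc ∑ k ∈ K, (n k : ℝ) ≤ ∑ k ∈ K, |c k| * H := Finset.sum_le_sum fun k _ => hn_le k
        _ = (∑ k ∈ K, |c k|) * H := by rw [Finset.sum_mul]
        _ ≤ H := mul_le_of_le_one_left hHpos.le hc
    exact_mod_cast this
  have hround : ‖∑ k ∈ K, c k • y k - (H : ℝ)⁻¹ • s.sum‖ ≤ a * (h : ℝ) ^ (-τ) := by
    have h1 : ∑ k ∈ K, c k • y k - (H : ℝ)⁻¹ • s.sum =
        ∑ k ∈ K, (|c k| - (H : ℝ)⁻¹ * n k) • v k := by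
      rw [hssum, Finset.smul_sum, ← Finset.sum_sub_distrib]
      refine Finset.sum_congr rfl fun k _ => ?_
      rw [hcv, smul_smul, sub_smul]
    rw [h1]
    calc ‖∑ k ∈ K, (|c k| - (H : ℝ)⁻¹ * n k) • v k‖ ≤ ∑ _k ∈ K, (H : ℝ)⁻¹ * a := by
          refine norm_sum_le_of_le _ fun k hk => ?_
          rw [norm_smul]
          refine mul_le_mul ?_ (hvn k hk) (norm_nonneg _) (by positivity)
          have e : |c k| - (H : ℝ)⁻¹ * n k = (H : ℝ)⁻¹ * (|c k| * H - n k) := by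
            field_simp
          have := hn_le k
          have := hn_lt k
          rw [e, Real.norm_of_nonneg (mul_nonneg (by positivity) (by linarith))]
          exact mul_le_of_le_one_right (by positivity) (by linarith)
      _ = M * ((H : ℝ)⁻¹ * a) := by rw [Finset.sum_const, nsmul_eq_mul]
      _ = (M / 2 ^ M) * (a * (h : ℝ)⁻¹) := by
          rw [hHR]; field_simp
      _ ≤ 1 * (a * (h : ℝ) ^ (-τ)) := by
          refine mul_le_mul ?_ ?_ (by positivity) zero_le_one
          · rw [div_le_one (by positivity)]
            exact_mod_cast Nat.lt_two_pow_self.le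
          · refine mul_le_mul_of_nonneg_left ?_ ha
            rw [← Real.rpow_neg_one]
            exact Real.rpow_le_rpow_of_exponent_le hh1 (by linarith)
      _ = _ := one_mul _
  obtain ⟨t, hts, htc, htn⟩ := hX.exists_sparse hp hρ ha hh M s
    (fun w hw => by obtain ⟨k, hk, rfl⟩ := hsv w hw; exact hvn k hk) hscard
  refine ⟨(h : ℝ)⁻¹ • t.sum, Finset.mem_image_of_mem _ (hmem t h (fun w hw => ?_) htc), ?_⟩
  · obtain ⟨k, hk, rfl⟩ := hsv w (Multiset.mem_of_le hts hw)
    exact hvW k hk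
  have hgs : ∑ l ∈ Finset.range M, x ^ (l + 1) ≤ (1 - x)⁻¹ := by
    rw [← tsum_geometric_of_lt_one hx0.le hx1]
    refine le_trans (Finset.sum_le_sum fun l _ => ?_)
      ((summable_geometric_of_lt_one hx0.le hx1).sum_le_tsum (Finset.range M)
        fun i _ => by positivity)
    exact pow_le_pow_of_le_one hx0.le hx1.le (Nat.le_succ l)
  have hhτ : (h : ℝ) ^ (-τ) ≤ 2 * ((h : ℝ) + 1) ^ (-τ) := by
    have e1 : (2 * (h : ℝ)) ^ (-τ) ≤ ((h : ℝ) + 1) ^ (-τ) :=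
      Real.rpow_le_rpow_of_nonpos (by positivity) (by linarith) (by linarith)
    have e2 : (h : ℝ) ^ (-τ) = 2 ^ τ * (2 * (h : ℝ)) ^ (-τ) := by
      rw [Real.mul_rpow (by norm_num) hh'.le, ← mul_assoc, ← Real.rpow_add (by norm_num)]
      simp
    have e3 : (2 : ℝ) ^ τ ≤ 2 := by
      simpa using Real.rpow_le_rpow_of_exponent_le (x := 2) (by norm_num) ht1
    rw [e2]
    exact mul_le_mul e3 e1 (by positivity) (by norm_num)
  rw [← hHR] at htn
  calc ‖∑ k ∈ K, c k • y k - (h : ℝ)⁻¹ • t.sum‖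
      ≤ ‖∑ k ∈ K, c k • y k - (H : ℝ)⁻¹ • s.sum‖ +
        ‖(H : ℝ)⁻¹ • s.sum - (h : ℝ)⁻¹ • t.sum‖ := norm_sub_le_norm_sub_add_norm_sub _ _ _
    _ ≤ a * (h : ℝ) ^ (-τ) + ρ * a * (h : ℝ) ^ (-τ) * (1 - x)⁻¹ := by
        refine add_le_add hround (htn.trans ?_)
        exact mul_le_mul_of_nonneg_left hgs (by positivity)
    _ = (1 + ρ * (1 - x)⁻¹) * a * (h : ℝ) ^ (-τ) := by ring
    _ ≤ (1 + ρ * (1 - x)⁻¹) * a * (2 * ((h : ℝ) + 1) ^ (-τ)) :=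
        mul_le_mul_of_nonneg_left hhτ (by positivity)
    _ = 2 * (1 + ρ * (1 - x)⁻¹) * a * ((h : ℝ) + 1) ^ (-τ) := by ring

/-- A grid cover of the absolutely convex hull of finitely many bounded vectors. -/
lemma exists_grid_cover {X : Type*} [NormedAddCommGroup X] [NormedSpace ℝ X] (K : Finset ℕ)
    (y : ℕ → X) {a : ℝ} (hy : ∀ k ∈ K, ‖y k‖ ≤ a) {H : ℕ} (hH : 0 < H) :
    ∃ T : Finset X, T.card ≤ (2 * H + 1) ^ K.card ∧
      ∀ c : ℕ → ℝ, ∑ k ∈ K, |c k| ≤ 1 →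
        ∃ t ∈ T, ‖∑ k ∈ K, c k • y k - t‖ ≤ K.card * a / H := by
  classical
  have hH' : (0 : ℝ) < H := by exact_mod_cast hH
  refine ⟨(Fintype.piFinset fun _ : K => Finset.Icc (-(H : ℤ)) H).image
    fun n => ∑ k : K, ((n k : ℝ) / H) • y k, ?_, fun c hc => ?_⟩
  · refine Finset.card_image_le.trans ?_
    rw [Fintype.card_piFinset, Finset.prod_const, Int.card_Icc, Finset.card_univ, Fintype.card_coe]
    exact Nat.pow_le_pow_left (by omega) _
  have hc1 : ∀ k ∈ K, |c k| ≤ 1 := fun k hk =>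
    (Finset.single_le_sum (f := fun k => |c k|) (fun i _ => abs_nonneg _) hk).trans hc
  refine ⟨_, Finset.mem_image_of_mem _ (a := fun k : K => ⌊c k * H⌋) ?_, ?_⟩
  · rw [Fintype.mem_piFinset]
    intro k
    have := abs_le.mp (hc1 k k.2)
    rw [Finset.mem_Icc]
    constructor
    · rw [Int.le_floor]; push_cast; nlinarith
    · rw [← Int.cast_le (R := ℝ)]
      refine (Int.floor_le _).trans ?_
      push_cast; nlinarith
  · rw [Finset.sum_coe_sort K fun k => (((⌊c k * H⌋ : ℤ) : ℝ) / H) • y k,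
      ← Finset.sum_sub_distrib]
    calc ‖∑ k ∈ K, (c k • y k - (((⌊c k * H⌋ : ℤ) : ℝ) / H) • y k)‖ ≤ ∑ _k ∈ K, (H : ℝ)⁻¹ * a := by
          refine norm_sum_le_of_le _ fun k hk => ?_
          rw [← sub_smul, norm_smul]
          refine mul_le_mul ?_ (hy k hk) (norm_nonneg _) (by positivity)
          have e : c k - ((⌊c k * H⌋ : ℤ) : ℝ) / H = (H : ℝ)⁻¹ * Int.fract (c k * H) := by
            rw [← Int.self_sub_floor]; field_simp
          rw [e, Real.norm_of_nonneg (mul_nonneg (by positivity) (Int.fract_nonneg _))]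
          exact mul_le_of_le_one_right (by positivity) (Int.fract_lt_one _).le
      _ = K.card * a / H := by
          rw [Finset.sum_const, nsmul_eq_mul]; field_simp

lemma opDyadEntropyNum_nonneg {X Y : Type*} [SeminormedAddCommGroup X] [SeminormedAddCommGroup Y]
    [NormedSpace ℝ X] [NormedSpace ℝ Y] (T : X →L[ℝ] Y) (n : ℕ) : 0 ≤ opDyadEntropyNum T n :=
  Real.sInf_nonneg fun _ hx => hx.1

/-- It is enough to cover the images of finitely supported sequences. -/
lemma opDyadEntropyNum_le_of_cover {X : Type*} [NormedAddCommGroup X] [NormedSpace ℝ X]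
    (T : lp (fun _ : ℕ => ℝ) 1 →L[ℝ] X) {n K₀ : ℕ} {ε : ℝ} (hε : 0 ≤ ε) (F : Finset X)
    (hF : F.card ≤ 2 ^ (n - 1))
    (hcov : ∀ K ≥ K₀, ∀ c : ℕ → ℝ, ∑ k ∈ Finset.range K, |c k| ≤ 1 →
      ∃ t ∈ F, ‖∑ k ∈ Finset.range K, c k • T (lp.single 1 k 1) - t‖ ≤ ε) :
    opDyadEntropyNum T n ≤ ε := by
  refine csInf_le ⟨0, fun _ hx => hx.1⟩ ⟨hε, F, hF, ?_⟩
  rintro _ ⟨ξ, hξ, rfl⟩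
  rw [mem_closedBall_zero_iff] at hξ
  have hclosed : IsClosed (⋃ x ∈ F, Metric.closedBall x ε) :=
    F.finite_toSet.isClosed_biUnion fun _ _ => Metric.isClosed_closedBall
  have hsum := ((lp.hasSum_single ENNReal.one_ne_top ξ).mapL T).tendsto_sum_nat
  refine hclosed.mem_of_tendsto hsum (Filter.eventually_atTop.mpr ⟨K₀, fun K hK => ?_⟩)
  have hc : ∑ k ∈ Finset.range K, |ξ k| ≤ 1 := by
    have := lp.sum_rpow_le_norm_rpow (p := 1) (by simp) ξ (Finset.range K)
    simp only [ENNReal.toReal_one, Real.rpow_one, Real.norm_eq_abs] at this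
    exact this.trans hξ
  obtain ⟨t, htF, ht⟩ := hcov K hK (fun k => ξ k) hc
  refine Set.mem_biUnion htF ?_
  rw [mem_closedBall_iff_norm]
  have hsingle : ∀ k, T (lp.single 1 k (ξ k)) = ξ k • T (lp.single 1 k 1) := fun k => by
    rw [← map_smul, ← lp.single_smul, smul_eq_mul, mul_one]
  rwa [Finset.sum_congr rfl fun k _ => hsingle k]

/-- Covers of consecutive blocks of coordinates combine to a cover of an initial segment. -/
lemma exists_block_cover {X : Type*} [NormedAddCommGroup X] [NormedSpace ℝ X] {C τ : ℝ}
    (hC : ∀ (K : Finset ℕ) (y : ℕ → X) (a : ℝ), 0 ≤ a → (∀ k ∈ K, ‖y k‖ ≤ a) →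
      ∀ h : ℕ, ∃ T : Finset X, T.card ≤ (2 * K.card + 1) ^ h ∧
        ∀ c : ℕ → ℝ, ∑ k ∈ K, |c k| ≤ 1 →
          ∃ t ∈ T, ‖∑ k ∈ K, c k • y k - t‖ ≤ C * a * ((h : ℝ) + 1) ^ (-τ))
    {y : ℕ → X} {σ : ℕ → ℝ} (hσ0 : ∀ n, 0 ≤ σ n) (hσm : Antitone σ) (hy : ∀ k, ‖y k‖ ≤ σ k)
    {N : ℕ → ℕ} (hN : Monotone N) (h : ℕ → ℕ) {H : ℕ} (hH : 0 < H) (I : ℕ) :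
    ∃ T : Finset X,
      T.card ≤ (2 * H + 1) ^ N 0 * ∏ i ∈ Finset.range I, (2 * N (i + 1) + 1) ^ h i ∧
      ∀ c : ℕ → ℝ, ∑ k ∈ Finset.range (N I), |c k| ≤ 1 →
        ∃ t ∈ T, ‖∑ k ∈ Finset.range (N I), c k • y k - t‖ ≤
          N 0 * σ 0 / H + ∑ i ∈ Finset.range I, C * σ (N i) * ((h i : ℝ) + 1) ^ (-τ) := by
  classical
  induction I with
  | zero =>
    obtain ⟨T, hT, hcov⟩ := exists_grid_cover (Finset.range (N 0)) y (a := σ 0)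
      (fun k _ => (hy k).trans (hσm (Nat.zero_le k))) hH
    rw [Finset.card_range] at hT hcov
    exact ⟨T, by simpa using hT, by simpa using hcov⟩
  | succ I ih =>
    obtain ⟨T, hT, hcov⟩ := ih
    obtain ⟨U, hU, hcovU⟩ := hC (Finset.Ico (N I) (N (I + 1))) y (σ (N I)) (hσ0 _)
      (fun k hk => (hy k).trans (hσm (Finset.mem_Ico.mp hk).1)) (h I)
    refine ⟨Finset.image₂ (· + ·) T U, ?_, fun c hc => ?_⟩
    · refine (Finset.card_image₂_le _ _ _).trans ?_
      rw [Finset.prod_range_succ, ← mul_assoc]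
      refine Nat.mul_le_mul hT (hU.trans (Nat.pow_le_pow_left ?_ _))
      rw [Nat.card_Ico]; omega
    · have hle := hN (Nat.le_succ I)
      rw [← Finset.sum_range_add_sum_Ico _ hle] at hc
      have h1 : 0 ≤ ∑ k ∈ Finset.range (N I), |c k| := Finset.sum_nonneg fun _ _ => abs_nonneg _
      have h2 : 0 ≤ ∑ k ∈ Finset.Ico (N I) (N (I + 1)), |c k| :=
        Finset.sum_nonneg fun _ _ => abs_nonneg _
      obtain ⟨t, ht, htn⟩ := hcov c (by linarith)
      obtain ⟨u, hu, hun⟩ := hcovU c (by linarith)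
      refine ⟨t + u, Finset.mem_image₂_of_mem ht hu, ?_⟩
      rw [← Finset.sum_range_add_sum_Ico _ hle, add_sub_add_comm, Finset.sum_range_succ,
        ← add_assoc]
      exact (norm_add_le _ _).trans (add_le_add htn hun)

lemma two_mul_two_pow_add_one_le (a : ℕ) : 2 * 2 ^ a + 1 ≤ 2 ^ (a + 2) := by
  have := Nat.one_le_two_pow (n := a)
  rw [pow_add]; omega

/-- The number of centres needed for the block cover with geometrically decreasing numbers of
sample points. -/
lemma exists_card_bound {κ : ℝ} (hκ : 1 < κ) :
    ∃ b : ℕ, ∀ m : ℕ, 1 ≤ m → ∀ I : ℕ,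
      (2 * 2 ^ (3 * m) + 1) ^ 2 ^ (2 ^ 0 * m) * ∏ i ∈ Finset.range I,
        (2 * 2 ^ (2 ^ (i + 1) * m) + 1) ^ ⌊(4 : ℝ) ^ m * 2 ^ (-(κ * i)) / m⌋₊ ≤
      2 ^ (2 ^ b * 4 ^ m) := by
  set w : ℝ := 2 ^ (1 - κ) with hw
  have hw0 : 0 < w := by positivity
  have hw1 : w < 1 := Real.rpow_lt_one_of_one_lt_of_neg (by norm_num) (by linarith)
  obtain ⟨b, hb⟩ := pow_unbounded_of_one_lt (5 + 4 * (1 - w)⁻¹) (one_lt_two (α := ℝ))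
  refine ⟨b, fun m hm I => ?_⟩
  have hm' : (1 : ℝ) ≤ m := by exact_mod_cast hm
  set h : ℕ → ℕ := fun i => ⌊(4 : ℝ) ^ m * 2 ^ (-(κ * i)) / m⌋₊ with hh
  have hexp : (3 * m + 2) * 2 ^ m + ∑ i ∈ Finset.range I, (2 ^ (i + 1) * m + 2) * h i ≤
      2 ^ b * 4 ^ m := by
    have hhead : (3 * m + 2) * 2 ^ m ≤ 5 * 4 ^ m := by
      have h1 : m < 2 ^ m := Nat.lt_two_pow_self
      have h2 : (4 : ℕ) ^ m = 2 ^ m * 2 ^ m := by rw [← mul_pow]; norm_num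
      rw [h2, ← mul_assoc]
      exact Nat.mul_le_mul_right _ (by omega)
    have hterm : ∀ i, ((2 ^ (i + 1) * m + 2 : ℝ)) * h i ≤ 4 * 4 ^ m * w ^ i := by
      intro i
      have h1 : (h i : ℝ) ≤ (4 : ℝ) ^ m * 2 ^ (-(κ * i)) / m := Nat.floor_le (by positivity)
      have h2 : (2 : ℝ) ≤ 2 ^ (i + 1) * m := by
        have : (2 : ℝ) ≤ 2 ^ (i + 1) := by
          simpa using pow_le_pow_right₀ (one_le_two (α := ℝ)) (Nat.le_add_left 1 i)
        nlinarith
      calc ((2 ^ (i + 1) * m + 2 : ℝ)) * h i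
          ≤ (2 * (2 ^ (i + 1) * m)) * ((4 : ℝ) ^ m * 2 ^ (-(κ * i)) / m) := by
            refine mul_le_mul (by linarith) h1 (by positivity) (by positivity)
        _ = 4 * 4 ^ m * (2 ^ i * 2 ^ (-(κ * i))) := by
            rw [pow_succ]; field_simp; ring
        _ = 4 * 4 ^ m * w ^ i := by
            rw [hw, ← Real.rpow_mul_natCast (by norm_num), ← Real.rpow_natCast 2 i,
              ← Real.rpow_add (by norm_num)]
            ring_nf
    have hgs : ∑ i ∈ Finset.range I, w ^ i ≤ (1 - w)⁻¹ := by
      rw [← tsum_geometric_of_lt_one hw0.le hw1]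
      exact (summable_geometric_of_lt_one hw0.le hw1).sum_le_tsum _ fun i _ => by positivity
    have hreal : (((3 * m + 2) * 2 ^ m + ∑ i ∈ Finset.range I, (2 ^ (i + 1) * m + 2) * h i : ℕ) : ℝ)
        ≤ ((2 ^ b * 4 ^ m : ℕ) : ℝ) := by
      have hhead' : ((3 * m + 2) * 2 ^ m : ℝ) ≤ 5 * 4 ^ m := by exact_mod_cast hhead
      push_cast
      calc ((3 * m + 2) * 2 ^ m : ℝ) + ∑ i ∈ Finset.range I, (2 ^ (i + 1) * m + 2 : ℝ) * h i
          ≤ 5 * 4 ^ m + ∑ i ∈ Finset.range I, 4 * 4 ^ m * w ^ i :=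
            add_le_add hhead' (Finset.sum_le_sum fun i _ => hterm i)
        _ = (5 + 4 * ∑ i ∈ Finset.range I, w ^ i) * 4 ^ m := by
            rw [← Finset.mul_sum]; ring
        _ ≤ 2 ^ b * 4 ^ m := by
            refine mul_le_mul_of_nonneg_right ?_ (by positivity)
            linarith
    exact_mod_cast hreal
  calc _ ≤ (2 ^ (3 * m + 2)) ^ 2 ^ (2 ^ 0 * m) *
        ∏ i ∈ Finset.range I, (2 ^ (2 ^ (i + 1) * m + 2)) ^ h i :=
        Nat.mul_le_mul (Nat.pow_le_pow_left (two_mul_two_pow_add_one_le _) _)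
          (Finset.prod_le_prod' fun i _ => Nat.pow_le_pow_left (two_mul_two_pow_add_one_le _) _)
    _ = 2 ^ ((3 * m + 2) * 2 ^ m + ∑ i ∈ Finset.range I, (2 ^ (i + 1) * m + 2) * h i) := by
        rw [← pow_mul, pow_zero, one_mul, pow_add 2 ((3 * m + 2) * 2 ^ m),
          ← Finset.prod_pow_eq_pow_sum]
        simp only [← pow_mul]
    _ ≤ _ := Nat.pow_le_pow_right (by norm_num) hexp

/-- Entropy numbers of an operator on `l₁` mapping the unit vectors to vectors of decreasing norm. -/
lemma IsTypePWith.exists_entropy_bound {X : Type*} [NormedAddCommGroup X] [NormedSpace ℝ X]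
    {p ρ β : ℝ} (hX : IsTypePWith X p ρ) (hp : 1 < p) (hρ : 0 ≤ ρ) (hβ : 1 - 1 / p < β)
    {σ : ℕ → ℝ} (hσ0 : ∀ n, 0 ≤ σ n) (hσm : Antitone σ) (T : lp (fun _ : ℕ => ℝ) 1 →L[ℝ] X)
    (hT : ∀ k, ‖T (lp.single 1 k 1)‖ ≤ σ k) :
    ∃ (C : ℝ) (b : ℕ), 0 < C ∧ ∀ m : ℕ, 1 ≤ m → ∀ M : ℝ,
      (∀ i : ℕ, 2 ^ (β * i) * σ (2 ^ (2 ^ i * m)) ≤ M) → ∀ k : ℕ, 2 ^ b * 4 ^ m + 1 ≤ k →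
        opDyadEntropyNum T k ≤
          C * (((4 : ℝ) ^ m) ^ (-(1 - 1 / p)) * (m : ℝ) ^ (1 - 1 / p) * M + ((4 : ℝ) ^ m)⁻¹) := by
  obtain ⟨C, hC0, hC⟩ := hX.exists_cover hp hρ
  have hτ0 : 0 < 1 - 1 / p := by
    rw [sub_pos, div_lt_one (by linarith)]; exact hp
  set τ : ℝ := 1 - 1 / p with hτ
  obtain ⟨κ, hκ1, hκβ⟩ : ∃ κ : ℝ, 1 < κ ∧ κ * τ < β := by
    obtain ⟨κ, h1, h2⟩ := exists_between ((one_lt_div hτ0).mpr hβ)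
    exact ⟨κ, h1, (lt_div_iff₀ hτ0).mp h2⟩
  obtain ⟨b, hb⟩ := exists_card_bound hκ1
  set x : ℝ := 2 ^ (κ * τ - β) with hx
  have hx0 : 0 < x := by positivity
  have hx1 : x < 1 := Real.rpow_lt_one_of_one_lt_of_neg (by norm_num) (by linarith)
  have hgeom : 0 < (1 - x)⁻¹ := inv_pos.mpr (by linarith)
  refine ⟨σ 0 + C * (1 - x)⁻¹ + 1, b, by have := hσ0 0; positivity, fun m hm M hM k hk => ?_⟩
  have hm' : (1 : ℝ) ≤ m := by exact_mod_cast hm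
  set N : ℕ → ℕ := fun i => 2 ^ (2 ^ i * m) with hN
  set h : ℕ → ℕ := fun i => ⌊(4 : ℝ) ^ m * 2 ^ (-(κ * i)) / m⌋₊ with hh
  have hNmono : Monotone N := by
    intro i j hij
    exact Nat.pow_le_pow_right (by norm_num)
      (Nat.mul_le_mul_right _ (Nat.pow_le_pow_right (by norm_num) hij))
  set A : ℝ := ((4 : ℝ) ^ m) ^ (-τ) * (m : ℝ) ^ τ with hA
  have hA0 : 0 < A := by positivity
  have hM0 : 0 ≤ M := (mul_nonneg (by positivity) (hσ0 _)).trans (hM 0)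
  have hh1 : ∀ i, ((h i : ℝ) + 1) ^ (-τ) ≤ A * 2 ^ (κ * τ * i) := by
    intro i
    have h1 : (4 : ℝ) ^ m * 2 ^ (-(κ * i)) / m ≤ (h i : ℝ) + 1 := (Nat.lt_floor_add_one _).le
    refine (Real.rpow_le_rpow_of_nonpos (by positivity) h1 (by linarith)).trans (le_of_eq ?_)
    rw [Real.div_rpow (by positivity) (by positivity),
      Real.mul_rpow (by positivity) (by positivity), Real.rpow_neg (Nat.cast_nonneg m),
      div_inv_eq_mul, ← Real.rpow_mul (by norm_num), hA]
    ring_nf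
  have hblock : ∀ i, σ (N i) * ((h i : ℝ) + 1) ^ (-τ) ≤ A * M * x ^ i := by
    intro i
    calc σ (N i) * ((h i : ℝ) + 1) ^ (-τ) ≤ σ (N i) * (A * 2 ^ (κ * τ * i)) :=
          mul_le_mul_of_nonneg_left (hh1 i) (hσ0 _)
      _ = A * (2 ^ (β * i) * σ (N i)) * x ^ i := by
          have : (2 : ℝ) ^ (κ * τ * i) = 2 ^ (β * i) * x ^ i := by
            rw [hx, ← Real.rpow_mul_natCast (by norm_num), ← Real.rpow_add (by norm_num)]
            ring_nf
          rw [this]; ring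
      _ ≤ A * M * x ^ i := by
          refine mul_le_mul_of_nonneg_right ?_ (by positivity)
          exact mul_le_mul_of_nonneg_left (hM i) hA0.le
  obtain ⟨I, hI⟩ : ∃ I : ℕ, h I = 0 := by
    obtain ⟨I, hI⟩ := pow_unbounded_of_one_lt ((4 : ℝ) ^ m) (one_lt_two (α := ℝ))
    refine ⟨I, Nat.floor_eq_zero.mpr ?_⟩
    rw [div_lt_one (by positivity)]
    refine lt_of_lt_of_le ?_ hm'
    rw [Real.rpow_neg (by norm_num), ← div_eq_mul_inv, div_lt_one (by positivity)]
    refine hI.trans_le ?_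
    rw [← Real.rpow_natCast]
    exact Real.rpow_le_rpow_of_exponent_le one_le_two
      (le_mul_of_one_le_left (Nat.cast_nonneg I) hκ1.le)
  obtain ⟨F, hF, hcov⟩ := exists_block_cover hC hσ0 hσm hT hNmono h (H := 2 ^ (3 * m))
    (by positivity) I
  have hgs : ∑ i ∈ Finset.range I, x ^ i ≤ (1 - x)⁻¹ := by
    rw [← tsum_geometric_of_lt_one hx0.le hx1]
    exact (summable_geometric_of_lt_one hx0.le hx1).sum_le_tsum _ fun i _ => by positivity
  have hhead : (N 0 : ℝ) * σ 0 / (2 ^ (3 * m) : ℕ) = σ 0 * ((4 : ℝ) ^ m)⁻¹ := by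
    have : (2 : ℝ) ^ (3 * m) = 2 ^ m * 4 ^ m := by
      rw [pow_mul, ← mul_pow]; norm_num
    simp only [hN, pow_zero, one_mul]
    push_cast
    rw [this]
    field_simp
  have hmid : ∑ i ∈ Finset.range I, C * σ (N i) * ((h i : ℝ) + 1) ^ (-τ) ≤
      C * (1 - x)⁻¹ * (A * M) := by
    calc ∑ i ∈ Finset.range I, C * σ (N i) * ((h i : ℝ) + 1) ^ (-τ)
        ≤ ∑ i ∈ Finset.range I, C * (A * M * x ^ i) := by
          refine Finset.sum_le_sum fun i _ => ?_
          rw [mul_assoc]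
          exact mul_le_mul_of_nonneg_left (hblock i) hC0.le
      _ = C * (A * M) * ∑ i ∈ Finset.range I, x ^ i := by
          rw [Finset.mul_sum]; exact Finset.sum_congr rfl fun i _ => by ring
      _ ≤ C * (A * M) * (1 - x)⁻¹ := mul_le_mul_of_nonneg_left hgs (by positivity)
      _ = _ := by ring
  have htail : σ (N I) ≤ A * M := by
    have h1 := hblock I
    rw [hI] at h1
    simp only [Nat.cast_zero, zero_add, Real.one_rpow, mul_one] at h1
    exact h1.trans (mul_le_of_le_one_right (by positivity) (pow_le_one₀ hx0.le hx1.le))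
  have hcard : F.card ≤ 2 ^ (k - 1) :=
    (hF.trans (hb m hm I)).trans (Nat.pow_le_pow_right (by norm_num) (by omega))
  have hq : 0 ≤ ((4 : ℝ) ^ m)⁻¹ := by positivity
  have hAM : 0 ≤ A * M := by positivity
  refine opDyadEntropyNum_le_of_cover T (K₀ := N I) ?_ F hcard fun K hK c hc => ?_
  · have := hσ0 0; positivity
  · rw [← Finset.sum_range_add_sum_Ico _ hK] at hc
    have h1 : 0 ≤ ∑ k ∈ Finset.range (N I), |c k| := Finset.sum_nonneg fun _ _ => abs_nonneg _
    have h2 : 0 ≤ ∑ k ∈ Finset.Ico (N I) K, |c k| := Finset.sum_nonneg fun _ _ => abs_nonneg _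
    obtain ⟨t, ht, htn⟩ := hcov c (by linarith)
    refine ⟨t, ht, ?_⟩
    have hrest : ‖∑ k ∈ Finset.Ico (N I) K, c k • T (lp.single 1 k 1)‖ ≤ σ (N I) := by
      calc ‖∑ k ∈ Finset.Ico (N I) K, c k • T (lp.single 1 k 1)‖
          ≤ ∑ k ∈ Finset.Ico (N I) K, |c k| * σ (N I) := by
            refine norm_sum_le_of_le _ fun k hk => ?_
            rw [norm_smul, Real.norm_eq_abs]
            exact mul_le_mul_of_nonneg_left
              ((hT k).trans (hσm (Finset.mem_Ico.mp hk).1)) (abs_nonneg _)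
        _ = (∑ k ∈ Finset.Ico (N I) K, |c k|) * σ (N I) := by rw [Finset.sum_mul]
        _ ≤ σ (N I) := mul_le_of_le_one_left (hσ0 _) (by linarith)
    rw [← Finset.sum_range_add_sum_Ico _ hK, add_sub_right_comm]
    refine (norm_add_le _ _).trans ?_
    rw [hhead] at htn
    have e1 : 0 ≤ σ 0 * (A * M) := mul_nonneg (hσ0 0) hAM
    have e2 : 0 ≤ C * (1 - x)⁻¹ * ((4 : ℝ) ^ m)⁻¹ := by positivity
    linarith

lemma rpow_le_of_comparable {x y c γ : ℝ} (hx : 0 < x) (hy : 0 < y) (hc : 1 ≤ c)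
    (hxy : x ≤ c * y) (hyx : y ≤ c * x) : x ^ γ ≤ c ^ |γ| * y ^ γ := by
  have hc0 : 0 < c := by linarith
  rcases le_total 0 γ with h | h
  · rw [abs_of_nonneg h, ← Real.mul_rpow hc0.le hy.le]
    exact Real.rpow_le_rpow hx.le hxy h
  · rw [abs_of_nonpos h, Real.rpow_neg hc0.le, ← div_eq_inv_mul, ← Real.div_rpow hy.le hc0.le]
    exact Real.rpow_le_rpow_of_nonpos (by positivity) ((div_le_iff₀' hc0).mpr hyx) h

lemma summable_rpow_mul_geometric (γ : ℝ) {x : ℝ} (hx0 : 0 ≤ x) (hx1 : x < 1) :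
    Summable fun m : ℕ => (m : ℝ) ^ γ * x ^ m := by
  rw [← summable_nat_add_iff 1]
  have hx : ‖x‖ < 1 := by rwa [Real.norm_of_nonneg hx0]
  have h0 : Summable fun m : ℕ => (m : ℝ) ^ ⌈γ⌉₊ * x ^ m :=
    summable_pow_mul_geometric_of_norm_lt_one ⌈γ⌉₊ hx
  have h := (summable_nat_add_iff 1).mpr h0
  refine Summable.of_nonneg_of_le (fun m => by positivity) (fun m => ?_) h
  refine mul_le_mul_of_nonneg_right ?_ (by positivity)
  rw [← Real.rpow_natCast _ ⌈γ⌉₊]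
  exact Real.rpow_le_rpow_of_exponent_le (by push_cast; linarith [Nat.cast_nonneg (α := ℝ) m])
    (Nat.le_ceil γ)

lemma sum_range_sum_Ico {u : ℕ → ℕ} (hu : Monotone u) (f : ℕ → ℝ) (n : ℕ) :
    ∑ m ∈ Finset.range n, ∑ j ∈ Finset.Ico (u m) (u (m + 1)), f j =
      ∑ j ∈ Finset.Ico (u 0) (u n), f j := by
  induction n with
  | zero => simp
  | succ n ih =>
    rw [Finset.sum_range_succ, ih,
      Finset.sum_Ico_consecutive _ (hu (Nat.zero_le n)) (hu (Nat.le_succ n))]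

lemma summable_sum_Ico {u : ℕ → ℕ} (hu : Monotone u) {f : ℕ → ℝ} (hf0 : ∀ j, 0 ≤ f j)
    (hf : Summable f) : Summable fun m => ∑ j ∈ Finset.Ico (u m) (u (m + 1)), f j := by
  refine summable_of_sum_range_le (c := ∑' j, f j)
    (fun m => Finset.sum_nonneg fun j _ => hf0 j) fun n => ?_
  rw [sum_range_sum_Ico hu]
  exact hf.sum_le_tsum _ fun j _ => hf0 j

lemma summable_of_sum_Ico_le {u : ℕ → ℕ} (hu : StrictMono u) {f B : ℕ → ℝ} (hf0 : ∀ j, 0 ≤ f j)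
    (hB : Summable B) (hfB : ∀ m, ∑ j ∈ Finset.Ico (u m) (u (m + 1)), f j ≤ B m) :
    Summable f := by
  have hblock : ∀ m, 0 ≤ ∑ j ∈ Finset.Ico (u m) (u (m + 1)), f j :=
    fun m => Finset.sum_nonneg fun j _ => hf0 j
  refine summable_of_sum_range_le (c := ∑ j ∈ Finset.range (u 0), f j + ∑' m, B m) hf0 fun n => ?_
  calc ∑ j ∈ Finset.range n, f j ≤ ∑ j ∈ Finset.range (u n), f j :=
        Finset.sum_le_sum_of_subset_of_nonneg
          (Finset.range_subset_range.mpr hu.le_apply) fun j _ _ => hf0 j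
    _ = ∑ j ∈ Finset.range (u 0), f j +
          ∑ m ∈ Finset.range n, ∑ j ∈ Finset.Ico (u m) (u (m + 1)), f j := by
        rw [sum_range_sum_Ico hu.monotone,
          Finset.sum_range_add_sum_Ico _ (hu.monotone (Nat.zero_le n))]
    _ ≤ _ := by
        refine add_le_add le_rfl ((Finset.sum_le_sum fun m _ => hfB m).trans ?_)
        exact hB.sum_le_tsum _ fun m _ => (hblock m).trans (hfB m)

lemma strictMono_two_pow : StrictMono fun l : ℕ => 2 ^ l :=
  fun _ _ h => Nat.pow_lt_pow_right (by norm_num) h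

lemma summable_two_pow_rpow_mul {γ : ℝ} {g : ℕ → ℝ} (hg0 : ∀ j, 0 ≤ g j) (hg : Antitone g)
    (h : Summable fun j : ℕ => ((j : ℝ) + 1) ^ (γ - 1) * g j) :
    Summable fun l : ℕ => ((2 : ℝ) ^ l) ^ γ * g (2 ^ l) := by
  rw [← summable_nat_add_iff 1]
  have hs := summable_sum_Ico strictMono_two_pow.monotone
    (fun j => mul_nonneg (by positivity) (hg0 j)) h
  refine Summable.of_nonneg_of_le (fun l => mul_nonneg (by positivity) (hg0 _)) (fun l => ?_)
    (hs.mul_left (2 ^ γ * 2 ^ |γ - 1|))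
  have hterm : ∀ j ∈ Finset.Ico ((2 : ℕ) ^ l) (2 ^ (l + 1)),
      ((2 : ℝ) ^ l) ^ (γ - 1) * g (2 ^ (l + 1)) ≤
        2 ^ |γ - 1| * (((j : ℝ) + 1) ^ (γ - 1) * g j) := by
    intro j hj
    obtain ⟨h1, h2⟩ := Finset.mem_Ico.mp hj
    have h1' : (2 : ℝ) ^ l ≤ j := by exact_mod_cast h1
    have h2' : (j : ℝ) + 1 ≤ 2 * 2 ^ l := by
      rw [pow_succ'] at h2; exact_mod_cast h2
    rw [← mul_assoc]
    refine mul_le_mul ?_ (hg h2.le) (hg0 _) (by positivity)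
    exact rpow_le_of_comparable (by positivity) (by positivity) one_le_two (by linarith)
      (by linarith)
  calc ((2 : ℝ) ^ (l + 1)) ^ γ * g (2 ^ (l + 1))
      = 2 ^ γ * ∑ _j ∈ Finset.Ico ((2 : ℕ) ^ l) (2 ^ (l + 1)),
          ((2 : ℝ) ^ l) ^ (γ - 1) * g (2 ^ (l + 1)) := by
        have hcard : 2 ^ (l + 1) - 2 ^ l = 2 ^ l := by rw [pow_succ]; omega
        rw [Finset.sum_const, Nat.card_Ico, hcard, nsmul_eq_mul, pow_succ,
          Real.mul_rpow (by positivity) (by norm_num), Real.rpow_sub_one (by positivity)]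
        push_cast
        field_simp
    _ ≤ 2 ^ γ * ∑ j ∈ Finset.Ico ((2 : ℕ) ^ l) (2 ^ (l + 1)),
          2 ^ |γ - 1| * (((j : ℝ) + 1) ^ (γ - 1) * g j) :=
        mul_le_mul_of_nonneg_left (Finset.sum_le_sum hterm) (by positivity)
    _ = _ := by rw [← Finset.mul_sum, mul_assoc]

lemma summable_rpow_mul_log {γ : ℝ} {g : ℕ → ℝ} (hg0 : ∀ l, 0 ≤ g l)
    (h : Summable fun l : ℕ => ((2 : ℝ) ^ l) ^ γ * g l) :
    Summable fun m : ℕ => (m : ℝ) ^ (γ - 1) * g (Nat.log 2 m) := by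
  refine summable_of_sum_Ico_le strictMono_two_pow
    (fun m => mul_nonneg (by positivity) (hg0 _)) (h.mul_left (2 ^ |γ - 1|)) fun l => ?_
  have hterm : ∀ m ∈ Finset.Ico ((2 : ℕ) ^ l) (2 ^ (l + 1)),
      (m : ℝ) ^ (γ - 1) * g (Nat.log 2 m) ≤ 2 ^ |γ - 1| * ((2 : ℝ) ^ l) ^ (γ - 1) * g l := by
    intro m hm
    obtain ⟨h1, h2⟩ := Finset.mem_Ico.mp hm
    rw [Nat.log_eq_of_pow_le_of_lt_pow h1 h2]
    have h1' : (2 : ℝ) ^ l ≤ m := by exact_mod_cast h1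
    have h2' : (m : ℝ) ≤ 2 * 2 ^ l := by
      rw [pow_succ'] at h2; exact_mod_cast h2.le
    refine mul_le_mul_of_nonneg_right ?_ (hg0 _)
    have : (0 : ℝ) < 2 ^ l := by positivity
    exact rpow_le_of_comparable (by linarith) this one_le_two h2' (by linarith)
  refine (Finset.sum_le_sum hterm).trans (le_of_eq ?_)
  have hcard : 2 ^ (l + 1) - 2 ^ l = 2 ^ l := by rw [pow_succ]; omega
  rw [Finset.sum_const, Nat.card_Ico, hcard, nsmul_eq_mul, Real.rpow_sub_one (by positivity)]
  push_cast
  field_simp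

/-- The maximal function along doubled indices inherits the summability of a decreasing
sequence. -/
lemma exists_summable_majorant {r s β : ℝ} (hr : 0 < r) (hs : 0 < s) (hβ : β < 1 / r)
    {g : ℕ → ℝ} (hg0 : ∀ j, 0 ≤ g j) (hg : Antitone g)
    (h : Summable fun j : ℕ => ((j : ℝ) + 1) ^ (s / r - 1) * g j ^ s) :
    ∃ M : ℕ → ℝ, (∀ m, 0 ≤ M m) ∧ (∀ m, 1 ≤ m → ∀ i : ℕ, 2 ^ (β * i) * g (2 ^ i * m) ≤ M m) ∧
      Summable fun m : ℕ => (m : ℝ) ^ (s / r - 1) * M m ^ s := by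
  set a : ℕ → ℝ := fun l => ((2 : ℝ) ^ l) ^ (s / r) * g (2 ^ l) ^ s with ha
  have ha0 : ∀ l, 0 ≤ a l := fun l => mul_nonneg (by positivity) (Real.rpow_nonneg (hg0 _) _)
  have hasum : Summable a := summable_two_pow_rpow_mul
    (fun j => Real.rpow_nonneg (hg0 j) s)
    (fun i j hij => Real.rpow_le_rpow (hg0 _) (hg hij) hs.le) h
  set x : ℝ := 2 ^ (-(s * (1 / r - β))) with hx
  have hx0 : 0 < x := by positivity
  have hx1 : x < 1 := Real.rpow_lt_one_of_one_lt_of_neg (by norm_num)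
    (neg_lt_zero.mpr (mul_pos hs (by linarith)))
  have hpair : Summable fun q : ℕ × ℕ => a (q.1 + q.2) * x ^ q.2 := by
    have h1 := hasum.mul_of_nonneg (summable_geometric_of_lt_one hx0.le hx1) ha0
      (fun i => by positivity)
    refine h1.comp_injective (i := fun q : ℕ × ℕ => (q.1 + q.2, q.2)) ?_
    rintro ⟨l, i⟩ ⟨l', i'⟩ hq
    simp only [Prod.mk.injEq] at hq ⊢
    omega
  have hF0 : ∀ l i, 0 ≤ a (l + i) * x ^ i := fun l i => mul_nonneg (ha0 _) (by positivity)
  set R : ℕ → ℝ := fun l => ∑' i, a (l + i) * x ^ i with hR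
  have hRsum : Summable R := hpair.prod
  have hR0 : ∀ l, 0 ≤ R l := fun l => tsum_nonneg (hF0 l)
  have hle : ∀ l i, a (l + i) * x ^ i ≤ R l := fun l i =>
    (hpair.prod_factor l).le_tsum i fun j _ => hF0 l j
  set Q : ℕ → ℝ := fun l => (((2 : ℝ) ^ l) ^ (-(s / r)) * R l) ^ (1 / s) with hQ
  have hbase : ∀ l, 0 ≤ ((2 : ℝ) ^ l) ^ (-(s / r)) * R l :=
    fun l => mul_nonneg (by positivity) (hR0 l)
  have hQ0 : ∀ l, 0 ≤ Q l := fun l => Real.rpow_nonneg (hbase l) _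
  have hQs : ∀ l, Q l ^ s = ((2 : ℝ) ^ l) ^ (-(s / r)) * R l := fun l => by
    rw [hQ, ← Real.rpow_mul (hbase l), one_div_mul_cancel hs.ne', Real.rpow_one]
  refine ⟨fun m => Q (Nat.log 2 m), fun m => hQ0 _, fun m hm i => ?_, ?_⟩
  · set l := Nat.log 2 m with hl
    have hlm : 2 ^ l ≤ m := Nat.pow_log_le_self 2 (by omega)
    have h1 : 2 ^ (β * i) * g (2 ^ i * m) ≤ 2 ^ (β * i) * g (2 ^ (l + i)) := by
      refine mul_le_mul_of_nonneg_left (hg ?_) (by positivity)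
      rw [pow_add, mul_comm]
      exact Nat.mul_le_mul_left _ hlm
    refine h1.trans ?_
    rw [← Real.rpow_le_rpow_iff (mul_nonneg (by positivity) (hg0 _)) (hQ0 _) hs, hQs,
      Real.mul_rpow (by positivity) (hg0 _)]
    refine le_trans (le_of_eq ?_) (mul_le_mul_of_nonneg_left (hle l i) (by positivity))
    have e : ((2 : ℝ) ^ (β * i)) ^ s =
        ((2 : ℝ) ^ l) ^ (-(s / r)) * (((2 : ℝ) ^ (l + i)) ^ (s / r) * x ^ i) := by
      rw [hx, ← Real.rpow_mul_natCast (by norm_num), ← Real.rpow_natCast 2 l,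
        ← Real.rpow_natCast 2 (l + i), ← Real.rpow_mul (by norm_num), ← Real.rpow_mul (by norm_num),
        ← Real.rpow_mul (by norm_num), ← Real.rpow_add (by norm_num),
        ← Real.rpow_add (by norm_num)]
      congr 1
      push_cast
      field_simp
      ring
    rw [e, ha]; ring
  · refine summable_rpow_mul_log (γ := s / r) (g := fun l => Q l ^ s)
      (fun l => Real.rpow_nonneg (hQ0 l) s) (hRsum.congr fun l => ?_)
    rw [hQs, ← mul_assoc, ← Real.rpow_add (by positivity), add_neg_cancel, Real.rpow_zero, one_mul]

lemma add_rpow_le_two_rpow_mul {x y s : ℝ} (hx : 0 ≤ x) (hy : 0 ≤ y) (hs : 0 ≤ s) :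
    (x + y) ^ s ≤ 2 ^ s * (x ^ s + y ^ s) := by
  have hx' := Real.rpow_nonneg hx s
  have hy' := Real.rpow_nonneg hy s
  have h2 : (0 : ℝ) < 2 ^ s := by positivity
  rcases le_total x y with h | h
  · calc (x + y) ^ s ≤ (2 * y) ^ s := Real.rpow_le_rpow (by positivity) (by linarith) hs
      _ = 2 ^ s * y ^ s := Real.mul_rpow (by norm_num) hy
      _ ≤ _ := mul_le_mul_of_nonneg_left (by linarith) h2.le
  · calc (x + y) ^ s ≤ (2 * x) ^ s := Real.rpow_le_rpow (by positivity) (by linarith) hs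
      _ = 2 ^ s * x ^ s := Real.mul_rpow (by norm_num) hx
      _ ≤ _ := mul_le_mul_of_nonneg_left (by linarith) h2.le

/-- Lorentz weights are comparable on the block `(2 ^ b * 4 ^ m, 2 ^ b * 4 ^ (m + 1)]`. -/
lemma exists_weight_le (b : ℕ) (γ δ : ℝ) :
    ∃ c : ℝ, 0 < c ∧ ∀ m k : ℕ, 1 ≤ m → 2 ^ b * 4 ^ m + 1 ≤ k → k ≤ 2 ^ b * 4 ^ (m + 1) →
      Real.logb 2 ((k : ℝ) + 1) ^ γ * (k : ℝ) ^ δ ≤ c * ((m : ℝ) ^ γ * ((4 : ℝ) ^ m) ^ δ) := by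
  refine ⟨((b : ℝ) + 5) ^ |γ| * ((2 : ℝ) ^ (b + 2)) ^ |δ|, by positivity,
    fun m k hm hk1 hk2 => ?_⟩
  have hm' : (1 : ℝ) ≤ m := by exact_mod_cast hm
  have hb : (0 : ℝ) ≤ b := Nat.cast_nonneg b
  have hk1' : (2 : ℝ) ^ b * 4 ^ m + 1 ≤ k := by exact_mod_cast hk1
  have hk2' : (k : ℝ) ≤ 2 ^ b * 4 ^ (m + 1) := by exact_mod_cast hk2
  have h4 : (0 : ℝ) < 4 ^ m := by positivity
  have hb1 : (1 : ℝ) ≤ 2 ^ b := one_le_pow₀ one_le_two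
  have hk3 : (4 : ℝ) ^ m ≤ k := by nlinarith
  have hk0 : (0 : ℝ) < k := by linarith
  have hk4 : (k : ℝ) ≤ 2 ^ (b + 2) * 4 ^ m := by
    calc (k : ℝ) ≤ 2 ^ b * 4 ^ (m + 1) := hk2'
      _ = 2 ^ (b + 2) * 4 ^ m := by ring
  have hL1 : (m : ℝ) ≤ Real.logb 2 ((k : ℝ) + 1) := by
    rw [Real.le_logb_iff_rpow_le one_lt_two (by linarith), Real.rpow_natCast]
    have : (2 : ℝ) ^ m ≤ 4 ^ m := pow_le_pow_left₀ (by norm_num) (by norm_num) m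
    linarith
  have hL2 : Real.logb 2 ((k : ℝ) + 1) ≤ (b + 5) * m := by
    have h1 : Real.logb 2 ((k : ℝ) + 1) ≤ ((b + 2 * m + 3 : ℕ) : ℝ) := by
      rw [Real.logb_le_iff_le_rpow one_lt_two (by linarith), Real.rpow_natCast]
      have e : (2 : ℝ) ^ (b + 2 * m + 3) = 2 * (2 ^ (b + 2) * 4 ^ m) := by
        have : (4 : ℝ) ^ m = 2 ^ (2 * m) := by rw [pow_mul]; norm_num
        rw [this]; ring
      have : (1 : ℝ) ≤ 4 ^ m := one_le_pow₀ (by norm_num)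
      rw [e]; linarith
    refine h1.trans ?_
    push_cast
    nlinarith
  have e1 : Real.logb 2 ((k : ℝ) + 1) ^ γ ≤ ((b : ℝ) + 5) ^ |γ| * (m : ℝ) ^ γ :=
    rpow_le_of_comparable (by linarith) (by linarith) (by linarith) hL2 (by nlinarith)
  have hb2 : (1 : ℝ) ≤ 2 ^ (b + 2) := one_le_pow₀ one_le_two
  have e2 : (k : ℝ) ^ δ ≤ ((2 : ℝ) ^ (b + 2)) ^ |δ| * ((4 : ℝ) ^ m) ^ δ :=
    rpow_le_of_comparable hk0 h4 hb2 hk4 (by nlinarith)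
  calc _ ≤ ((b : ℝ) + 5) ^ |γ| * (m : ℝ) ^ γ * (((2 : ℝ) ^ (b + 2)) ^ |δ| * ((4 : ℝ) ^ m) ^ δ) :=
        mul_le_mul e1 e2 (by positivity) (by positivity)
    _ = _ := by ring

lemma exists_block_index {b k : ℕ} (hk : 2 ^ b * 4 + 1 ≤ k) :
    ∃ m : ℕ, 1 ≤ m ∧ 2 ^ b * 4 ^ m + 1 ≤ k ∧ k ≤ 2 ^ b * 4 ^ (m + 1) := by
  have hb : 0 < 2 ^ b := by positivity
  have h4 : 4 ≤ (k - 1) / 2 ^ b := by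
    rw [Nat.le_div_iff_mul_le hb, mul_comm]; omega
  refine ⟨Nat.log 4 ((k - 1) / 2 ^ b), Nat.log_pos (by norm_num) h4, ?_, ?_⟩
  · have h := Nat.pow_log_le_self 4 (x := (k - 1) / 2 ^ b) (by omega)
    rw [Nat.le_div_iff_mul_le hb, mul_comm] at h
    omega
  · have h := Nat.lt_pow_succ_log_self (b := 4) (by norm_num) ((k - 1) / 2 ^ b)
    rw [Nat.div_lt_iff_lt_mul hb, mul_comm, Nat.succ_eq_add_one] at h
    omega

lemma geometric_ratio_lt_one {s τ : ℝ} (hs : 0 < s) (hτ : τ < 1) :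
    (4 : ℝ) ^ (s * (τ - 1)) < 1 :=
  Real.rpow_lt_one_of_one_lt_of_neg (by norm_num) (mul_neg_of_pos_of_neg hs (by linarith))

lemma exists_lorentzTop_bound {E g : ℕ → ℝ} {C τ r β : ℝ} {b : ℕ} (hE : ∀ k, 0 ≤ E k)
    (hC : 0 < C) (hτ : τ < 1) (hβ : β < 1 / r) (hr : 0 < r)
    (hkey : ∀ m : ℕ, 1 ≤ m → ∀ M : ℝ, (∀ i : ℕ, 2 ^ (β * i) * g (2 ^ i * m) ≤ M) →
      ∀ k : ℕ, 2 ^ b * 4 ^ m + 1 ≤ k →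
        E k ≤ C * (((4 : ℝ) ^ m) ^ (-τ) * (m : ℝ) ^ τ * M + ((4 : ℝ) ^ m)⁻¹))
    {C₀ : ℝ} (hg : ∀ j : ℕ, ((j : ℝ) + 1) ^ (1 / r) * g j ≤ C₀) (hg0 : ∀ j, 0 ≤ g j) :
    ∃ B : ℝ, ∀ n : ℕ, 1 ≤ n →
      Real.logb 2 ((n : ℝ) + 1) ^ (-(τ - 1 / r)) * (n : ℝ) ^ τ * E n ≤ B := by
  set γ : ℝ := -(τ - 1 / r) with hγ
  set x : ℝ := 4 ^ (1 * (τ - 1)) with hx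
  have hx0 : 0 < x := by positivity
  have hsum := summable_rpow_mul_geometric γ hx0.le (geometric_ratio_lt_one one_pos hτ)
  obtain ⟨c, hc0, hc⟩ := exists_weight_le b γ τ
  have hC₀ : 0 ≤ C₀ := (mul_nonneg (by positivity) (hg0 0)).trans (hg 0)
  have hw : ∀ n : ℕ, 0 ≤ Real.logb 2 ((n : ℝ) + 1) ^ γ * (n : ℝ) ^ τ * E n := fun n => by
    have : 0 ≤ Real.logb 2 ((n : ℝ) + 1) :=
      Real.logb_nonneg one_lt_two (by linarith [Nat.cast_nonneg (α := ℝ) n])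
    exact mul_nonneg (by positivity) (hE n)
  set S := ∑ n ∈ Finset.range (2 ^ b * 4 + 1),
    Real.logb 2 ((n : ℝ) + 1) ^ γ * (n : ℝ) ^ τ * E n with hS
  set G := ∑' m : ℕ, (m : ℝ) ^ γ * x ^ m with hG
  have hG0 : 0 ≤ G := tsum_nonneg fun m => by positivity
  have hS0 : 0 ≤ S := Finset.sum_nonneg fun n _ => hw n
  refine ⟨S + c * C * (C₀ + G), fun n _ => ?_⟩
  rcases lt_or_ge n (2 ^ b * 4 + 1) with hn | hn
  · have h1 := Finset.single_le_sum (f := fun n : ℕ =>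
      Real.logb 2 ((n : ℝ) + 1) ^ γ * (n : ℝ) ^ τ * E n) (fun i _ => hw i) (Finset.mem_range.mpr hn)
    have h2 : 0 ≤ c * C * (C₀ + G) := by positivity
    exact h1.trans (by linarith)
  · obtain ⟨m, hm, hk1, hk2⟩ := exists_block_index hn
    have hm' : (0 : ℝ) < m := by exact_mod_cast hm
    have hM : ∀ i : ℕ, 2 ^ (β * i) * g (2 ^ i * m) ≤ C₀ * (m : ℝ) ^ (-(1 / r)) := by
      intro i
      have hj : (0 : ℝ) < 2 ^ i * m := by positivity
      have h1 : ((2 : ℝ) ^ i * m) ^ (1 / r) * g (2 ^ i * m) ≤ C₀ := by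
        refine le_trans (mul_le_mul_of_nonneg_right ?_ (hg0 _)) (hg (2 ^ i * m))
        refine Real.rpow_le_rpow hj.le ?_ (by positivity)
        push_cast; linarith
      have h2 : (2 : ℝ) ^ (β * i) ≤ ((2 : ℝ) ^ i) ^ (1 / r) := by
        rw [← Real.rpow_natCast, ← Real.rpow_mul (by norm_num)]
        refine Real.rpow_le_rpow_of_exponent_le one_le_two ?_
        rw [mul_comm (i : ℝ)]
        exact mul_le_mul_of_nonneg_right hβ.le (Nat.cast_nonneg i)
      calc 2 ^ (β * i) * g (2 ^ i * m) ≤ ((2 : ℝ) ^ i) ^ (1 / r) * g (2 ^ i * m) :=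
            mul_le_mul_of_nonneg_right h2 (hg0 _)
        _ = ((2 : ℝ) ^ i * m) ^ (1 / r) * g (2 ^ i * m) * (m : ℝ) ^ (-(1 / r)) := by
            rw [Real.mul_rpow (by positivity) hm'.le, Real.rpow_neg hm'.le]
            field_simp
        _ ≤ _ := mul_le_mul_of_nonneg_right h1 (by positivity)
    have hEn := hkey m hm _ hM n hk1
    have hterm : (m : ℝ) ^ γ * x ^ m ≤ G := hsum.le_tsum m fun i _ => by positivity
    calc _ ≤ c * ((m : ℝ) ^ γ * ((4 : ℝ) ^ m) ^ τ) *
          (C * (((4 : ℝ) ^ m) ^ (-τ) * (m : ℝ) ^ τ * (C₀ * (m : ℝ) ^ (-(1 / r))) +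
            ((4 : ℝ) ^ m)⁻¹)) :=
          mul_le_mul (hc m n hm hk1 hk2) hEn (hE n) (by positivity)
      _ = c * C * (C₀ * ((m : ℝ) ^ γ * (m : ℝ) ^ τ * (m : ℝ) ^ (-(1 / r))) *
            (((4 : ℝ) ^ m) ^ τ * ((4 : ℝ) ^ m) ^ (-τ)) +
            (m : ℝ) ^ γ * (((4 : ℝ) ^ m) ^ τ * ((4 : ℝ) ^ m)⁻¹)) := by ring
      _ = c * C * (C₀ + (m : ℝ) ^ γ * x ^ m) := by
          have e1 : (m : ℝ) ^ γ * (m : ℝ) ^ τ * (m : ℝ) ^ (-(1 / r)) = 1 := by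
            rw [← Real.rpow_add hm', ← Real.rpow_add hm']
            have : γ + τ + -(1 / r) = 0 := by rw [hγ]; ring
            rw [this, Real.rpow_zero]
          have e2 : ((4 : ℝ) ^ m) ^ τ * ((4 : ℝ) ^ m) ^ (-τ) = 1 := by
            rw [← Real.rpow_add (by positivity), add_neg_cancel, Real.rpow_zero]
          have e3 : ((4 : ℝ) ^ m) ^ τ * ((4 : ℝ) ^ m)⁻¹ = x ^ m := by
            rw [← Real.rpow_neg_one, ← Real.rpow_add (by positivity), hx,
              ← Real.rpow_mul_natCast (by norm_num), ← Real.rpow_natCast_mul (by norm_num)]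
            ring_nf
          rw [e1, e2, e3]; ring
      _ ≤ c * C * (C₀ + G) := mul_le_mul_of_nonneg_left (by linarith) (by positivity)
      _ ≤ _ := by linarith

lemma summable_lorentz {E g : ℕ → ℝ} {C τ r s β : ℝ} {b : ℕ} (hE : ∀ k, 0 ≤ E k)
    (hC : 0 < C) (hτ : τ < 1) (hβ : β < 1 / r) (hr : 0 < r) (hs : 0 < s)
    (hkey : ∀ m : ℕ, 1 ≤ m → ∀ M : ℝ, (∀ i : ℕ, 2 ^ (β * i) * g (2 ^ i * m) ≤ M) →
      ∀ k : ℕ, 2 ^ b * 4 ^ m + 1 ≤ k →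
        E k ≤ C * (((4 : ℝ) ^ m) ^ (-τ) * (m : ℝ) ^ τ * M + ((4 : ℝ) ^ m)⁻¹))
    (hg0 : ∀ j, 0 ≤ g j) (hg : Antitone g)
    (h : Summable fun j : ℕ => ((j : ℝ) + 1) ^ (s / r - 1) * g j ^ s) :
    Summable fun n : ℕ => Real.logb 2 ((n : ℝ) + 2) ^ (-((1 / s + τ - 1 / r) * s)) *
      ((n : ℝ) + 1) ^ (s * τ - 1) * E (n + 1) ^ s := by
  obtain ⟨M, hM0, hM, hMsum⟩ := exists_summable_majorant hr hs hβ hg0 hg h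
  set γ : ℝ := -((1 / s + τ - 1 / r) * s) with hγ
  have hγ' : γ + τ * s = s / r - 1 := by rw [hγ]; field_simp; ring
  set x : ℝ := 4 ^ (s * (τ - 1)) with hx
  have hx0 : 0 < x := by positivity
  have hgeo := summable_rpow_mul_geometric γ hx0.le (geometric_ratio_lt_one hs hτ)
  obtain ⟨c, hc0, hc⟩ := exists_weight_le b γ (s * τ - 1)
  set D : ℝ := 2 ^ (b + 2) * c * (C ^ s * 2 ^ s) with hD
  have hBsum : Summable fun m : ℕ =>
      D * ((m : ℝ) ^ (s / r - 1) * M m ^ s + (m : ℝ) ^ γ * x ^ m) := (hMsum.add hgeo).mul_left _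
  have hu : StrictMono fun m : ℕ => 2 ^ b * 4 ^ (m + 1) := fun i j hij =>
    Nat.mul_lt_mul_of_pos_left (Nat.pow_lt_pow_right (by norm_num) (by omega)) (by positivity)
  refine summable_of_sum_Ico_le hu (fun n => ?_) ((summable_nat_add_iff 1).mpr hBsum) fun m => ?_
  · have : 0 ≤ Real.logb 2 ((n : ℝ) + 2) :=
      Real.logb_nonneg one_lt_two (by linarith [Nat.cast_nonneg (α := ℝ) n])
    exact mul_nonneg (by positivity) (Real.rpow_nonneg (hE _) _)
  · generalize hm1 : m + 1 = q
    have hq : 1 ≤ q := by omega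
    have hq' : (0 : ℝ) < q := by exact_mod_cast hq
    have hMq := hM0 q
    set Z : ℝ := c * ((q : ℝ) ^ γ * ((4 : ℝ) ^ q) ^ (s * τ - 1)) *
      (C ^ s * (2 ^ s * ((((4 : ℝ) ^ q) ^ (-τ) * (q : ℝ) ^ τ * M q) ^ s +
        (((4 : ℝ) ^ q)⁻¹) ^ s))) with hZ
    have hZ0 : 0 ≤ Z := by positivity
    have hterm : ∀ n ∈ Finset.Ico ((2 : ℕ) ^ b * 4 ^ q) (2 ^ b * 4 ^ (q + 1)),
        Real.logb 2 ((n : ℝ) + 2) ^ γ * ((n : ℝ) + 1) ^ (s * τ - 1) * E (n + 1) ^ s ≤ Z := by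
      intro n hn
      obtain ⟨h1, h2⟩ := Finset.mem_Ico.mp hn
      have hw := hc q (n + 1) hq (by omega) (by omega)
      have e : (((n + 1 : ℕ) : ℝ)) + 1 = (n : ℝ) + 2 := by push_cast; ring
      rw [e, Nat.cast_add_one] at hw
      have hEn := hkey q hq (M q) (hM q hq) (n + 1) (by omega)
      refine mul_le_mul hw ?_ (Real.rpow_nonneg (hE _) _) (by positivity)
      refine (Real.rpow_le_rpow (hE _) hEn hs.le).trans ?_
      rw [Real.mul_rpow hC.le (by positivity)]
      exact mul_le_mul_of_nonneg_left
        (add_rpow_le_two_rpow_mul (by positivity) (by positivity) hs.le) (by positivity)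
    calc _ ≤ ∑ _n ∈ Finset.Ico ((2 : ℕ) ^ b * 4 ^ q) (2 ^ b * 4 ^ (q + 1)), Z :=
          Finset.sum_le_sum hterm
      _ ≤ (2 ^ (b + 2) * 4 ^ q) * Z := by
          rw [Finset.sum_const, Nat.card_Ico, nsmul_eq_mul]
          refine mul_le_mul_of_nonneg_right ?_ hZ0
          have : 2 ^ b * 4 ^ (q + 1) - 2 ^ b * 4 ^ q ≤ 2 ^ (b + 2) * 4 ^ q := by
            refine (Nat.sub_le _ _).trans (le_of_eq ?_)
            ring
          exact_mod_cast this
      _ = D * ((q : ℝ) ^ (s / r - 1) * M q ^ s + (q : ℝ) ^ γ * x ^ q) := by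
          have h4 : (0 : ℝ) < 4 ^ q := by positivity
          have e1 : (((4 : ℝ) ^ q) ^ (-τ) * (q : ℝ) ^ τ * M q) ^ s =
              (((4 : ℝ) ^ q) ^ (s * τ))⁻¹ * (q : ℝ) ^ (τ * s) * M q ^ s := by
            rw [Real.mul_rpow (by positivity) hMq, Real.mul_rpow (by positivity) (by positivity),
              ← Real.rpow_mul h4.le, ← Real.rpow_mul hq'.le, ← Real.rpow_neg h4.le]
            ring_nf
          have e2 : (((4 : ℝ) ^ q)⁻¹) ^ s = (((4 : ℝ) ^ q) ^ (s * τ))⁻¹ * x ^ q := by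
            rw [hx, ← Real.rpow_mul_natCast (by norm_num), ← Real.rpow_neg_one,
              ← Real.rpow_mul h4.le, ← Real.rpow_neg h4.le, ← Real.rpow_natCast_mul (by norm_num),
              ← Real.rpow_natCast_mul (by norm_num), ← Real.rpow_add (by norm_num)]
            ring_nf
          have e3 : (q : ℝ) ^ (s / r - 1) = (q : ℝ) ^ γ * (q : ℝ) ^ (τ * s) := by
            rw [← Real.rpow_add hq', hγ']
          rw [hZ, e1, e2, e3, Real.rpow_sub_one h4.ne', hD]
          field_simp

/-- `X` Banach of type `p`, `1 < p ≤ 2`, `S : l₁ → X` bounded,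
`D_σ : l₁ → l₁` the diagonal operator of a non-increasing non-negative `σ`, `T = S D_σ`.
If `0 < r < p'` and `0 < s ≤ ∞`, then `(σ_{2^{n-1}}) ∈ l_{r,s}` implies
`(e_n(T)) ∈ l_{p',s,α}` with `α = 1/s + 1/p' - 1/r` (`1/s = 0` when `s = ∞`). -/
theorem stmt6 {X : Type*} [NormedAddCommGroup X] [NormedSpace ℝ X] [CompleteSpace X]
    (p p' r : ℝ) (hp1 : 1 < p) (hp2 : p ≤ 2) (hX : IsTypeP X p)
    (hp' : 1 / p + 1 / p' = 1) (hr0 : 0 < r) (hrp : r < p')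
    (σ : ℕ → ℝ) (hσ0 : ∀ n, 0 ≤ σ n) (hσm : Antitone σ)
    (S : lp (fun _ : ℕ => ℝ) 1 →L[ℝ] X)
    (D : lp (fun _ : ℕ => ℝ) 1 →L[ℝ] lp (fun _ : ℕ => ℝ) 1)
    (hD : ∀ (ξ : lp (fun _ : ℕ => ℝ) 1) (n : ℕ), (D ξ : ∀ _ : ℕ, ℝ) n = σ n * (ξ : ∀ _ : ℕ, ℝ) n) :
    (∀ s : ℝ, 0 < s →
      (MemLorentz r s 0 fun n => σ (2 ^ (n - 1))) →
        MemLorentz p' s (1 / s + 1 / p' - 1 / r) fun n => opDyadEntropyNum (S.comp D) n) ∧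
    ((MemLorentzTop r 0 fun n => σ (2 ^ (n - 1))) →
      MemLorentzTop p' (1 / p' - 1 / r) fun n => opDyadEntropyNum (S.comp D) n) := by
  obtain ⟨ρ, hρ, hρX⟩ := hX
  set τ : ℝ := 1 / p' with hτdef
  have hτp : 1 - 1 / p = τ := by linarith
  have hp0 : 0 < 1 / p := by positivity
  have hτ1 : τ < 1 := by linarith
  have hτr : τ < 1 / r := one_div_lt_one_div_of_lt hr0 hrp
  obtain ⟨β, hβ, hβr⟩ := exists_between hτr
  set T := S.comp D with hTdef
  have hT : ∀ k, ‖T (lp.single 1 k 1)‖ ≤ ‖S‖ * σ k := by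
    intro k
    have hDk : D (lp.single 1 k 1) = σ k • lp.single 1 k (1 : ℝ) := by
      ext n
      rw [hD]
      rcases eq_or_ne n k with rfl | h
      · simp
      · simp [h]
    rw [hTdef, ContinuousLinearMap.comp_apply, hDk]
    refine (S.le_opNorm _).trans (mul_le_mul_of_nonneg_left ?_ (norm_nonneg _))
    rw [norm_smul, lp.norm_single (by norm_num), Real.norm_of_nonneg (hσ0 k)]
    simp
  obtain ⟨C, b, hC, hbound⟩ := hρX.exists_entropy_bound hp1 hρ.le (hτp ▸ hβ)
    (fun n => mul_nonneg (norm_nonneg S) (hσ0 n)) (hσm.const_mul (norm_nonneg S)) T hT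
  rw [hτp] at hbound
  have hkey : ∀ m : ℕ, 1 ≤ m → ∀ M : ℝ, (∀ i : ℕ, 2 ^ (β * i) * σ (2 ^ (2 ^ i * m)) ≤ M) →
      ∀ k : ℕ, 2 ^ b * 4 ^ m + 1 ≤ k → opDyadEntropyNum T k ≤
        C * (‖S‖ + 1) * (((4 : ℝ) ^ m) ^ (-τ) * (m : ℝ) ^ τ * M + ((4 : ℝ) ^ m)⁻¹) := by
    intro m hm M hM k hk
    have hM0 : 0 ≤ M := (mul_nonneg (by positivity) (hσ0 _)).trans (hM 0)
    refine (hbound m hm (‖S‖ * M) (fun i => ?_) k hk).trans ?_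
    · rw [mul_left_comm]
      exact mul_le_mul_of_nonneg_left (hM i) (norm_nonneg S)
    · rw [mul_assoc C]
      refine mul_le_mul_of_nonneg_left ?_ hC.le
      have h1 : 0 ≤ ((4 : ℝ) ^ m) ^ (-τ) * (m : ℝ) ^ τ * M := by positivity
      have h2 : 0 ≤ ‖S‖ * ((4 : ℝ) ^ m)⁻¹ := by positivity
      linarith
  have hC' : 0 < C * (‖S‖ + 1) := by positivity
  have hg : Antitone fun j : ℕ => σ (2 ^ j) :=
    fun i j hij => hσm (Nat.pow_le_pow_right two_pos hij)
  refine ⟨fun s hs h => ?_, fun ⟨C₀, h⟩ => ?_⟩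
  · have h' : Summable fun j : ℕ => ((j : ℝ) + 1) ^ (s / r - 1) * σ (2 ^ j) ^ s := by
      simpa [MemLorentz] using h
    have := summable_lorentz (opDyadEntropyNum_nonneg T) hC' hτ1 hβr hr0 hs hkey
      (fun j => hσ0 _) hg h'
    unfold MemLorentz
    rwa [show s / p' - 1 = s * τ - 1 by rw [hτdef]; ring]
  · exact exists_lorentzTop_bound (g := fun j => σ (2 ^ j)) (opDyadEntropyNum_nonneg T) hC' hτ1
      hβr hr0 hkey (fun j => by simpa using h (j + 1) (by omega)) fun j => hσ0 _
end

section
/- Define d(s,t) := (∫_0^1 |K(s,x) − K(t,x)|^q dx)^{1/q} for s,t ∈ [0,1]. Then d is a pseudo-metric on [0,1], and: in the case (WS) of the weakly singular kernel K(t,x) = k(|t−x|) one has d(s,t) ≤ 4^{1/q} (∫_0^{|s−t|} (k(u))^q du)^{1/q} for all 0 ≤ s,t ≤ 1; and in the case (VO) of the Volterra kernel one has (∫_0^{|s−t|} (k(u))^q du)^{1/q} ≤ d(s,t) ≤ 2^{1/q} (∫_0^{|s−t|} (k(u))^q du)^{1/q} for all 0 ≤ s,t ≤ 1. -/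
open MeasureTheory

/-- The distance between two translates of a convolution kernel `f` in `L_q[0,1]`. -/
noncomputable def translateDist (q : ℝ) (f : ℝ → ℝ) (s t : ℝ) : ℝ :=
  (∫ x in (0:ℝ)..1, |f (s - x) - f (t - x)| ^ q) ^ (1 / q)

lemma abs_sub_rpow_le_sub_rpow {q a b : ℝ} (hq : 1 ≤ q) (hb : 0 ≤ b) (hab : b ≤ a) :
    |a - b| ^ q ≤ a ^ q - b ^ q := by
  have h := Real.add_rpow_le_rpow_add (sub_nonneg.2 hab) hb hq
  rw [sub_add_cancel] at h
  rw [abs_of_nonneg (sub_nonneg.2 hab)]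
  linarith

lemma translateDist_nonneg (q : ℝ) (f : ℝ → ℝ) (s t : ℝ) : 0 ≤ translateDist q f s t :=
  Real.rpow_nonneg (intervalIntegral.integral_nonneg zero_le_one
    fun _ _ => Real.rpow_nonneg (abs_nonneg _) _) _

lemma translateDist_self {q : ℝ} (hq : 1 ≤ q) (f : ℝ → ℝ) (s : ℝ) :
    translateDist q f s s = 0 := by
  have h : q ≠ 0 := by positivity
  simp [translateDist, h]

lemma translateDist_comm (q : ℝ) (f : ℝ → ℝ) (s t : ℝ) :
    translateDist q f s t = translateDist q f t s := by
  simp only [translateDist, abs_sub_comm (f (s - _))]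

section

variable {q : ℝ} {f : ℝ → ℝ}

lemma MeasureTheory.MemLp.comp_const_sub (hf : MemLp f (ENNReal.ofReal q) volume) (s : ℝ) :
    MemLp (fun x => f (s - x)) (ENNReal.ofReal q) volume :=
  hf.comp_measurePreserving (Measure.measurePreserving_sub_left volume s)

lemma MeasureTheory.MemLp.integrable_abs_rpow (hq : 1 ≤ q)
    (hf : MemLp f (ENNReal.ofReal q) volume) : Integrable (fun x => |f x| ^ q) := by
  have hq0 : 0 < q := by positivity
  simpa [ENNReal.toReal_ofReal hq0.le] using
    hf.integrable_norm_rpow (by simpa using hq0) ENNReal.ofReal_ne_top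

lemma translateDist_triangle (hq : 1 ≤ q) (hf : MemLp f (ENNReal.ofReal q) volume)
    (s t u : ℝ) :
    translateDist q f s u ≤ translateDist q f s t + translateDist q f t u := by
  have hq0 : 0 < q := by positivity
  have hm (r : ℝ) : MemLp (fun x => f (r - x)) (ENNReal.ofReal q)
      (volume.restrict (Set.Ioc 0 1)) := (hf.comp_const_sub r).restrict _
  have key (r v : ℝ) : translateDist q f r v = lpNorm ((fun x => f (r - x)) - fun x => f (v - x))
      (ENNReal.ofReal q) (volume.restrict (Set.Ioc 0 1)) := by
    rw [lpNorm_eq_integral_norm_rpow_toReal (by simpa using hq0) ENNReal.ofReal_ne_top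
      ((hm r).sub (hm v)).1, ENNReal.toReal_ofReal hq0.le, translateDist,
      intervalIntegral.integral_of_le zero_le_one, one_div]
    rfl
  simp only [key]
  exact lpNorm_sub_le_lpNorm_sub_add_lpNorm_sub (hm s) (hm t) (by simpa using hq)

lemma integral_abs_sub_rpow_le_of_even (hq : 1 ≤ q) (hf : MemLp f (ENNReal.ofReal q) volume)
    (hf0 : ∀ y, 0 ≤ f y) (heven : ∀ y, f (-y) = f y) (hanti : AntitoneOn f (Set.Ioi 0))
    {s t : ℝ} (ht : 0 ≤ t) (hts : t ≤ s) (hs : s ≤ 1) :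
    ∫ x in (0:ℝ)..1, |f (s - x) - f (t - x)| ^ q ≤ 4 * ∫ u in (0:ℝ)..(s - t), f u ^ q := by
  have hi : Integrable (fun y => f y ^ q) := by
    simpa [abs_of_nonneg (hf0 _)] using hf.integrable_abs_rpow hq
  have hii (a b : ℝ) : IntervalIntegrable (fun y => f y ^ q) volume a b := hi.intervalIntegrable
  have hic (r a b : ℝ) : IntervalIntegrable (fun x => f (r - x) ^ q) volume a b :=
    (hi.comp_sub_left r).intervalIntegrable
  have hD (a b : ℝ) : IntervalIntegrable (fun x => |f (s - x) - f (t - x)| ^ q) volume a b :=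
    (((hf.comp_const_sub s).sub (hf.comp_const_sub t)).integrable_abs_rpow hq).intervalIntegrable
  have hle {y z : ℝ} (hy : y ≠ 0) (hyz : |y| ≤ |z|) : f z ≤ f y := by
    have habs (y : ℝ) : f |y| = f y := by
      rcases abs_choice y with h | h <;> simp [h, heven]
    rw [← habs y, ← habs z]
    have : 0 < |y| := abs_pos.2 hy
    exact hanti this (this.trans_le hyz) hyz
  set m := (s + t) / 2 with hm
  set E : ℝ → ℝ := fun y => ∫ u in (0:ℝ)..y, f u ^ q with hE
  have hsub (r a b : ℝ) : ∫ x in a..b, f (r - x) ^ q = E (r - a) - E (r - b) := by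
    rw [intervalIntegral.integral_comp_sub_left (fun y => f y ^ q) r,
      intervalIntegral.integral_interval_sub_left (hii _ _) (hii _ _)]
  have hEodd (y : ℝ) : E (-y) = - E y := by
    have h := intervalIntegral.integral_comp_neg (a := 0) (b := y) (fun u => f u ^ q)
    simp only [heven, neg_zero] at h
    simp only [hE]
    rw [h, intervalIntegral.integral_symm]
  have hEmono {y z : ℝ} (hyz : y ≤ z) : E y ≤ E z := by
    have h := intervalIntegral.integral_interval_sub_left (hii 0 z) (hii 0 y)
    have : 0 ≤ ∫ u in y..z, f u ^ q :=
      intervalIntegral.integral_nonneg hyz fun u _ => Real.rpow_nonneg (hf0 u) q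
    simp only [hE]
    linarith
  have hleft : ∫ x in (0:ℝ)..m, |f (s - x) - f (t - x)| ^ q ≤
      ∫ x in (0:ℝ)..m, (f (t - x) ^ q - f (s - x) ^ q) := by
    refine intervalIntegral.integral_mono_ae_restrict (by linarith) (hD _ _)
      ((hic _ _ _).sub (hic _ _ _)) ?_
    filter_upwards [ae_restrict_mem measurableSet_Icc, ae_restrict_of_ae (volume.ae_ne t)]
      with x hx hxt
    rw [abs_sub_comm]
    refine abs_sub_rpow_le_sub_rpow hq (hf0 _) (hle (sub_ne_zero.2 hxt.symm) ?_)
    rw [abs_of_nonneg (by linarith [hx.2] : 0 ≤ s - x)]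
    exact abs_le.2 ⟨by linarith [hx.2], by linarith⟩
  have hright : ∫ x in m..1, |f (s - x) - f (t - x)| ^ q ≤
      ∫ x in m..1, (f (s - x) ^ q - f (t - x) ^ q) := by
    refine intervalIntegral.integral_mono_ae_restrict (by linarith) (hD _ _)
      ((hic _ _ _).sub (hic _ _ _)) ?_
    filter_upwards [ae_restrict_mem measurableSet_Icc, ae_restrict_of_ae (volume.ae_ne s)]
      with x hx hxs
    refine abs_sub_rpow_le_sub_rpow hq (hf0 _) (hle (sub_ne_zero.2 hxs.symm) ?_)
    rw [abs_of_nonpos (by linarith [hx.1] : t - x ≤ 0)]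
    exact abs_le.2 ⟨by linarith, by linarith [hx.1]⟩
  rw [intervalIntegral.integral_sub (hic _ _ _) (hic _ _ _), hsub, hsub] at hleft hright
  rw [← intervalIntegral.integral_add_adjacent_intervals (hD 0 m) (hD m 1)]
  have e₁ : s - m = (s - t) / 2 := by rw [hm]; ring
  have e₂ : t - m = -((s - t) / 2) := by rw [hm]; ring
  rw [e₁, e₂, hEodd] at hleft hright
  have h₁ : E ((s - t) / 2) ≤ E (s - t) := hEmono (by linarith)
  have h₂ : E (t - 1) ≤ E (s - 1) := hEmono (by linarith)
  have h₃ : E (t - 0) ≤ E (s - 0) := hEmono (by linarith)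
  change _ ≤ 4 * E (s - t)
  linarith

lemma integral_abs_sub_rpow_le_of_causal (hq : 1 ≤ q) (hf : MemLp f (ENNReal.ofReal q) volume)
    (hf0 : ∀ y, 0 ≤ f y) (hcausal : ∀ y ≤ 0, f y = 0) (hanti : AntitoneOn f (Set.Ioi 0))
    {s t : ℝ} (ht : 0 ≤ t) (hts : t ≤ s) (hs : s ≤ 1) :
    (∫ u in (0:ℝ)..(s - t), f u ^ q) ≤ ∫ x in (0:ℝ)..1, |f (s - x) - f (t - x)| ^ q ∧
    ∫ x in (0:ℝ)..1, |f (s - x) - f (t - x)| ^ q ≤ 2 * ∫ u in (0:ℝ)..(s - t), f u ^ q := by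
  have hi : Integrable (fun y => f y ^ q) := by
    simpa [abs_of_nonneg (hf0 _)] using hf.integrable_abs_rpow hq
  have hii (a b : ℝ) : IntervalIntegrable (fun y => f y ^ q) volume a b := hi.intervalIntegrable
  have hic (r a b : ℝ) : IntervalIntegrable (fun x => f (r - x) ^ q) volume a b :=
    (hi.comp_sub_left r).intervalIntegrable
  have hD (a b : ℝ) : IntervalIntegrable (fun x => |f (s - x) - f (t - x)| ^ q) volume a b :=
    (((hf.comp_const_sub s).sub (hf.comp_const_sub t)).integrable_abs_rpow hq).intervalIntegrable
  have hleft : ∫ x in (0:ℝ)..t, |f (s - x) - f (t - x)| ^ q ≤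
      ∫ x in (0:ℝ)..t, (f (t - x) ^ q - f (s - x) ^ q) := by
    refine intervalIntegral.integral_mono_on_of_le_Ioo ht (hD _ _)
      ((hic _ _ _).sub (hic _ _ _)) fun x hx => ?_
    have hx' : 0 < t - x := sub_pos.2 hx.2
    rw [abs_sub_comm]
    exact abs_sub_rpow_le_sub_rpow hq (hf0 _)
      (hanti hx' (hx'.trans_le (by linarith)) (by linarith))
  have hleft0 : 0 ≤ ∫ x in (0:ℝ)..t, |f (s - x) - f (t - x)| ^ q :=
    intervalIntegral.integral_nonneg ht fun _ _ => Real.rpow_nonneg (abs_nonneg _) _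
  have hmid : ∫ x in t..s, |f (s - x) - f (t - x)| ^ q = ∫ u in (0:ℝ)..(s - t), f u ^ q := by
    rw [← sub_self s, ← intervalIntegral.integral_comp_sub_left (fun y => f y ^ q) s]
    refine intervalIntegral.integral_congr_Ioo_of_le hts fun x hx => ?_
    simp [hcausal (t - x) (by linarith [hx.1]), abs_of_nonneg (hf0 _)]
  have hright : ∫ x in s..1, |f (s - x) - f (t - x)| ^ q = 0 := by
    rw [intervalIntegral.integral_congr_Ioo_of_le (g := fun _ => (0:ℝ)) hs fun x hx => ?_]
    · simp
    · have hq0 : q ≠ 0 := by positivity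
      simp [hcausal (t - x) (by linarith [hx.1]), hcausal (s - x) (by linarith [hx.1]), hq0]
  rw [intervalIntegral.integral_sub (hic _ _ _) (hic _ _ _),
    intervalIntegral.integral_comp_sub_left (fun y => f y ^ q) s,
    intervalIntegral.integral_comp_sub_left (fun y => f y ^ q) t, sub_self, sub_zero,
    sub_zero] at hleft
  have hs' := intervalIntegral.integral_add_adjacent_intervals (hii 0 (s - t)) (hii (s - t) s)
  have hst : ∫ u in (0:ℝ)..t, f u ^ q ≤ ∫ u in (0:ℝ)..s, f u ^ q :=
    intervalIntegral.integral_mono_interval le_rfl ht hts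
      (ae_of_all _ fun u => Real.rpow_nonneg (hf0 u) q) (hii _ _)
  rw [← intervalIntegral.integral_add_adjacent_intervals (hD 0 s) (hD s 1),
    ← intervalIntegral.integral_add_adjacent_intervals (hD 0 t) (hD t s), hmid, hright]
  constructor <;> linarith

lemma translateDist_le_of_even (hq : 1 ≤ q) (hf : MemLp f (ENNReal.ofReal q) volume)
    (hf0 : ∀ y, 0 ≤ f y) (heven : ∀ y, f (-y) = f y) (hanti : AntitoneOn f (Set.Ioi 0))
    {s t : ℝ} (hs : s ∈ Set.Icc (0:ℝ) 1) (ht : t ∈ Set.Icc (0:ℝ) 1) :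
    translateDist q f s t ≤ 4 ^ (1 / q) * (∫ u in (0:ℝ)..|s - t|, f u ^ q) ^ (1 / q) := by
  wlog hts : t ≤ s generalizing s t
  · rw [translateDist_comm, abs_sub_comm]
    exact this ht hs (le_of_not_ge hts)
  rw [abs_of_nonneg (sub_nonneg.2 hts), ← Real.mul_rpow (by norm_num)
    (intervalIntegral.integral_nonneg (sub_nonneg.2 hts) fun u _ => Real.rpow_nonneg (hf0 u) q)]
  refine Real.rpow_le_rpow ?_
    (integral_abs_sub_rpow_le_of_even hq hf hf0 heven hanti ht.1 hts hs.2) (by positivity)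
  exact intervalIntegral.integral_nonneg zero_le_one fun _ _ => Real.rpow_nonneg (abs_nonneg _) _

lemma translateDist_bounds_of_causal (hq : 1 ≤ q) (hf : MemLp f (ENNReal.ofReal q) volume)
    (hf0 : ∀ y, 0 ≤ f y) (hcausal : ∀ y ≤ 0, f y = 0) (hanti : AntitoneOn f (Set.Ioi 0))
    {s t : ℝ} (hs : s ∈ Set.Icc (0:ℝ) 1) (ht : t ∈ Set.Icc (0:ℝ) 1) :
    (∫ u in (0:ℝ)..|s - t|, f u ^ q) ^ (1 / q) ≤ translateDist q f s t ∧
    translateDist q f s t ≤ 2 ^ (1 / q) * (∫ u in (0:ℝ)..|s - t|, f u ^ q) ^ (1 / q) := by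
  wlog hts : t ≤ s generalizing s t
  · rw [translateDist_comm, abs_sub_comm]
    exact this ht hs (le_of_not_ge hts)
  have h0 : 0 ≤ ∫ u in (0:ℝ)..(s - t), f u ^ q :=
    intervalIntegral.integral_nonneg (sub_nonneg.2 hts) fun u _ => Real.rpow_nonneg (hf0 u) q
  obtain ⟨h₁, h₂⟩ := integral_abs_sub_rpow_le_of_causal hq hf hf0 hcausal hanti ht.1 hts hs.2
  rw [abs_of_nonneg (sub_nonneg.2 hts), ← Real.mul_rpow (by norm_num) h0]
  exact ⟨Real.rpow_le_rpow h0 h₁ (by positivity),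
    Real.rpow_le_rpow (h0.trans h₁) h₂ (by positivity)⟩

end

/-- With `d(s,t) = (∫₀¹ |K(s,x) − K(t,x)|^q dx)^{1/q}`, `d` is a
pseudo-metric on `[0,1]`; for the weakly singular kernel `K(t,x) = k(|t−x|)` one has
`d(s,t) ≤ 4^{1/q} (∫₀^{|s−t|} k(u)^q du)^{1/q}`, and for the Volterra kernel
`(∫₀^{|s−t|} k(u)^q du)^{1/q} ≤ d(s,t) ≤ 2^{1/q} (∫₀^{|s−t|} k(u)^q du)^{1/q}`. -/
theorem stmt11 (q : ℝ) (hq1 : 1 < q) (k : ℝ → ℝ)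
    (hk0 : ∀ x ∈ Set.Ioc (0 : ℝ) 1, 0 ≤ k x)
    (hkc : ContinuousOn k (Set.Ioc 0 1))
    (hkd : StrictAntiOn k (Set.Ioc 0 1))
    (hksing : Filter.Tendsto k (nhdsWithin 0 (Set.Ioi 0)) Filter.atTop)
    (hkq : MeasureTheory.IntegrableOn (fun x => k x ^ q) (Set.Ioc 0 1)) :
    (let KWS : ℝ → ℝ → ℝ := fun t x => k |t - x|
     let d : ℝ → ℝ → ℝ := fun s t => (∫ x in (0:ℝ)..1, |KWS s x - KWS t x| ^ q) ^ (1 / q)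
     (∀ s ∈ Set.Icc (0:ℝ) 1, ∀ t ∈ Set.Icc (0:ℝ) 1,
        0 ≤ d s t ∧ d s s = 0 ∧ d s t = d t s) ∧
     (∀ s ∈ Set.Icc (0:ℝ) 1, ∀ t ∈ Set.Icc (0:ℝ) 1, ∀ u ∈ Set.Icc (0:ℝ) 1,
        d s u ≤ d s t + d t u) ∧
     (∀ s ∈ Set.Icc (0:ℝ) 1, ∀ t ∈ Set.Icc (0:ℝ) 1,
        d s t ≤ (4:ℝ) ^ (1 / q) * (∫ u in (0:ℝ)..|s - t|, k u ^ q) ^ (1 / q))) ∧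
    (let KVO : ℝ → ℝ → ℝ := fun t x => if x < t then k (t - x) else 0
     let d : ℝ → ℝ → ℝ := fun s t => (∫ x in (0:ℝ)..1, |KVO s x - KVO t x| ^ q) ^ (1 / q)
     (∀ s ∈ Set.Icc (0:ℝ) 1, ∀ t ∈ Set.Icc (0:ℝ) 1,
        0 ≤ d s t ∧ d s s = 0 ∧ d s t = d t s) ∧
     (∀ s ∈ Set.Icc (0:ℝ) 1, ∀ t ∈ Set.Icc (0:ℝ) 1, ∀ u ∈ Set.Icc (0:ℝ) 1,
        d s u ≤ d s t + d t u) ∧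
     (∀ s ∈ Set.Icc (0:ℝ) 1, ∀ t ∈ Set.Icc (0:ℝ) 1,
        (∫ u in (0:ℝ)..|s - t|, k u ^ q) ^ (1 / q) ≤ d s t ∧
        d s t ≤ (2:ℝ) ^ (1 / q) * (∫ u in (0:ℝ)..|s - t|, k u ^ q) ^ (1 / q))) := by
  have hq : 1 ≤ q := hq1.le
  have hq0 : 0 < q := by positivity
  set g : ℝ → ℝ := (Set.Ioc (0:ℝ) 1).indicator k with hg
  have gk {y : ℝ} (hy : y ∈ Set.Ioc (0:ℝ) 1) : g y = k y := Set.indicator_of_mem hy k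
  have g_nonneg (y : ℝ) : 0 ≤ g y := Set.indicator_nonneg hk0 y
  have g_causal (y : ℝ) (hy : y ≤ 0) : g y = 0 :=
    Set.indicator_of_notMem (fun h => absurd h.1 hy.not_gt) k
  have g_anti : AntitoneOn g (Set.Ioi 0) := by
    intro y hy z hz hyz
    by_cases h : z ≤ 1
    · rw [gk ⟨hy, hyz.trans h⟩, gk ⟨hz, h⟩]
      exact hkd.antitoneOn ⟨hy, hyz.trans h⟩ ⟨hz, h⟩ hyz
    · rw [hg, Set.indicator_of_notMem (fun h' => h h'.2) k]
      exact g_nonneg y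
  have g_memLp : MemLp g (ENNReal.ofReal q) volume := by
    rw [hg, memLp_indicator_iff_restrict measurableSet_Ioc, ← integrable_norm_rpow_iff
      (hkc.aestronglyMeasurable measurableSet_Ioc) (by simpa using hq0) ENNReal.ofReal_ne_top,
      ENNReal.toReal_ofReal hq0.le]
    refine IntegrableOn.congr_fun hkq (fun x hx => ?_) measurableSet_Ioc
    simp [abs_of_nonneg (hk0 x hx)]
  have g_integral {a : ℝ} (ha0 : 0 ≤ a) (ha1 : a ≤ 1) :
      ∫ u in (0:ℝ)..a, k u ^ q = ∫ u in (0:ℝ)..a, g u ^ q :=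
    intervalIntegral.integral_congr_Ioo_of_le ha0 fun u hu => by
      simp only [gk ⟨hu.1, hu.2.le.trans ha1⟩]
  have abs_sub_le_one {s t : ℝ} (hs : s ∈ Set.Icc (0:ℝ) 1) (ht : t ∈ Set.Icc (0:ℝ) 1) :
      |s - t| ≤ 1 := abs_le.2 ⟨by linarith [hs.1, ht.2], by linarith [hs.2, ht.1]⟩
  constructor
  · intro KWS d
    have f_memLp : MemLp (fun y => g |y|) (ENNReal.ofReal q) volume := by
      have h := g_memLp.add (g_memLp.comp_measurePreserving (Measure.measurePreserving_neg volume))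
      refine (memLp_congr_ae (ae_of_all _ fun y => ?_)).1 h
      rcases le_total 0 y with hy | hy
      · simp [abs_of_nonneg hy, g_causal (-y) (by linarith)]
      · simp [abs_of_nonpos hy, g_causal y hy]
    have f_anti : AntitoneOn (fun y => g |y|) (Set.Ioi 0) :=
      g_anti.congr fun y hy => by simp only [abs_of_pos (Set.mem_Ioi.1 hy)]
    have hd {s t : ℝ} (hs : s ∈ Set.Icc (0:ℝ) 1) (ht : t ∈ Set.Icc (0:ℝ) 1) :
        d s t = translateDist q (fun y => g |y|) s t := by
      simp only [d, translateDist]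
      congr 1
      refine intervalIntegral.integral_congr_ae ?_
      filter_upwards [volume.ae_ne s, volume.ae_ne t] with x hxs hxt hx
      rw [Set.uIoc_of_le zero_le_one] at hx
      have hx' : x ∈ Set.Icc (0:ℝ) 1 := ⟨hx.1.le, hx.2⟩
      simp only [KWS, gk ⟨abs_pos.2 (sub_ne_zero.2 hxs.symm), abs_sub_le_one hs hx'⟩,
        gk ⟨abs_pos.2 (sub_ne_zero.2 hxt.symm), abs_sub_le_one ht hx'⟩]
    refine ⟨fun s hs t ht => ?_, fun s hs t ht u hu => ?_, fun s hs t ht => ?_⟩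
    · rw [hd hs ht, hd hs hs, hd ht hs]
      exact ⟨translateDist_nonneg .., translateDist_self hq .., translateDist_comm ..⟩
    · rw [hd hs hu, hd hs ht, hd ht hu]
      exact translateDist_triangle hq f_memLp s t u
    · rw [hd hs ht, g_integral (abs_nonneg _) (abs_sub_le_one hs ht)]
      have h := translateDist_le_of_even hq f_memLp (fun y => g_nonneg |y|)
        (fun y => by simp only [abs_neg]) f_anti hs ht
      rwa [intervalIntegral.integral_congr_Ioo_of_le (g := fun u => g u ^ q) (abs_nonneg (s - t))
        fun u hu => by simp only [abs_of_pos hu.1]] at h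
  · intro KVO d
    have hK {r x : ℝ} (hr : r ∈ Set.Icc (0:ℝ) 1) (hx : 0 < x) : KVO r x = g (r - x) := by
      by_cases h : x < r
      · simp only [KVO, if_pos h]
        rw [gk ⟨sub_pos.2 h, by linarith [hr.2]⟩]
      · simp only [KVO, if_neg h]
        rw [g_causal _ (by linarith)]
    have hd {s t : ℝ} (hs : s ∈ Set.Icc (0:ℝ) 1) (ht : t ∈ Set.Icc (0:ℝ) 1) :
        d s t = translateDist q g s t := by
      simp only [d, translateDist]
      congr 1
      refine intervalIntegral.integral_congr_Ioo_of_le zero_le_one fun x hx => ?_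
      simp only [hK hs hx.1, hK ht hx.1]
    refine ⟨fun s hs t ht => ?_, fun s hs t ht u hu => ?_, fun s hs t ht => ?_⟩
    · rw [hd hs ht, hd hs hs, hd ht hs]
      exact ⟨translateDist_nonneg .., translateDist_self hq .., translateDist_comm ..⟩
    · rw [hd hs hu, hd hs ht, hd ht hu]
      exact translateDist_triangle hq g_memLp s t u
    · rw [hd hs ht, g_integral (abs_nonneg _) (abs_sub_le_one hs ht)]
      exact translateDist_bounds_of_causal hq g_memLp g_nonneg g_causal g_anti hs ht
end

section
/- Let k(x) = x^{−τ} with 0 < τ < 1/q, and define d(s,t) := (∫_0^1 |K(s,x) − K(t,x)|^q dx)^{1/q} for s,t ∈ [0,1]. Then: in the case (WS) of the weakly singular kernel, d(s,t) ≤ 4^{1/q} (1 − qτ)^{−1/q} |s−t|^{1/q − τ} for all 0 ≤ s,t ≤ 1; and in the case (VO) of the Volterra kernel, (1 − qτ)^{−1/q} |s−t|^{1/q − τ} ≤ d(s,t) ≤ 2^{1/q} (1 − qτ)^{−1/q} |s−t|^{1/q − τ} for all 0 ≤ s,t ≤ 1. -/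
open MeasureTheory

theorem abs_sub_rpow_le_rpow_sub_rpow {u v q : ℝ} (hq : 1 ≤ q) (hv : 0 ≤ v) (hvu : v ≤ u) :
    |u - v| ^ q ≤ u ^ q - v ^ q := by
  rw [abs_of_nonneg (sub_nonneg.2 hvu)]
  have h := Real.add_rpow_le_rpow_add (sub_nonneg.2 hvu) hv hq
  rw [sub_add_cancel] at h
  linarith

theorem abs_sub_rpow_le_rpow_add_rpow {u v q : ℝ} (hq : 1 ≤ q) (hu : 0 ≤ u) (hv : 0 ≤ v) :
    |u - v| ^ q ≤ u ^ q + v ^ q := by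
  have hu' := Real.rpow_nonneg hu q
  have hv' := Real.rpow_nonneg hv q
  rcases le_total v u with h | h
  · linarith [abs_sub_rpow_le_rpow_sub_rpow hq hv h]
  · rw [abs_sub_comm]
    linarith [abs_sub_rpow_le_rpow_sub_rpow hq hu h]

theorem intervalIntegrable_abs_rpow {r : ℝ} (hr : -1 < r) (a b : ℝ) :
    IntervalIntegrable (fun x : ℝ => |x| ^ r) volume a b := by
  have hpos : ∀ c : ℝ, 0 ≤ c → IntervalIntegrable (fun x : ℝ => |x| ^ r) volume 0 c := by
    intro c hc
    refine (intervalIntegral.intervalIntegrable_rpow' hr).congr ?_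
    intro x hx
    rw [Set.uIoc_of_le hc] at hx
    simp only [abs_of_pos hx.1]
  have h0 : ∀ c : ℝ, IntervalIntegrable (fun x : ℝ => |x| ^ r) volume 0 c := by
    intro c
    rcases le_total 0 c with hc | hc
    · exact hpos c hc
    · rw [← neg_zero, ← neg_neg c, IntervalIntegrable.iff_comp_neg]
      simpa using hpos (-c) (by linarith)
  exact (h0 a).symm.trans (h0 b)

theorem intervalIntegrable_abs_sub_rpow {r : ℝ} (hr : -1 < r) (c a b : ℝ) :
    IntervalIntegrable (fun x : ℝ => |c - x| ^ r) volume a b := by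
  simpa using (intervalIntegrable_abs_rpow hr (c - a) (c - b)).comp_sub_left c

theorem integral_abs_sub_rpow_of_le {p : ℝ} (hp : p < 1) {c l r : ℝ} (hlr : l ≤ r) (hrc : r ≤ c) :
    ∫ x in l..r, |c - x| ^ (-p) = ((c - l) ^ (1 - p) - (c - r) ^ (1 - p)) / (1 - p) := by
  have h : ∫ x in l..r, |c - x| ^ (-p) = ∫ x in l..r, (c - x) ^ (-p) := by
    refine intervalIntegral.integral_congr fun x hx => ?_
    rw [Set.uIcc_of_le hlr] at hx
    simp only [abs_of_nonneg (show 0 ≤ c - x by linarith [hx.2])]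
  rw [h, intervalIntegral.integral_comp_sub_left (fun y => y ^ (-p)) c,
    integral_rpow (Or.inl (by linarith)), neg_add_eq_sub]

theorem integral_abs_sub_rpow_of_ge {p : ℝ} (hp : p < 1) {c l r : ℝ} (hcl : c ≤ l) (hlr : l ≤ r) :
    ∫ x in l..r, |c - x| ^ (-p) = ((r - c) ^ (1 - p) - (l - c) ^ (1 - p)) / (1 - p) := by
  have h : ∫ x in l..r, |c - x| ^ (-p) = ∫ x in l..r, (x - c) ^ (-p) := by
    refine intervalIntegral.integral_congr fun x hx => ?_
    rw [Set.uIcc_of_le hlr] at hx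
    simp only [abs_sub_comm c x, abs_of_nonneg (show 0 ≤ x - c by linarith [hx.1])]
  rw [h, intervalIntegral.integral_comp_sub_right (fun y => y ^ (-p)) c,
    integral_rpow (Or.inl (by linarith)), neg_add_eq_sub]

theorem abs_sub_rpow_neg_rpow (c x q τ : ℝ) :
    (|c - x| ^ (-τ)) ^ q = |c - x| ^ (-(q * τ)) := by
  rw [← Real.rpow_mul (abs_nonneg _)]
  congr 1
  ring

/-- The kernel `x ↦ |t - x| ^ (-τ)` restricted to `x < t`. -/
noncomputable def volterraKernel (τ t x : ℝ) : ℝ := if x < t then (t - x) ^ (-τ) else 0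

theorem volterraKernel_of_lt {τ t x : ℝ} (h : x < t) : volterraKernel τ t x = |t - x| ^ (-τ) := by
  rw [volterraKernel, if_pos h, abs_of_pos (sub_pos.2 h)]

theorem volterraKernel_of_le {τ t x : ℝ} (h : t ≤ x) : volterraKernel τ t x = 0 :=
  if_neg h.not_gt

theorem volterraKernel_nonneg (τ t x : ℝ) : 0 ≤ volterraKernel τ t x := by
  rcases lt_or_ge x t with h | h
  · rw [volterraKernel_of_lt h]; positivity
  · rw [volterraKernel_of_le h]

theorem volterraKernel_le (τ t x : ℝ) : volterraKernel τ t x ≤ |t - x| ^ (-τ) := by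
  rcases lt_or_ge x t with h | h
  · rw [volterraKernel_of_lt h]
  · rw [volterraKernel_of_le h]; positivity

theorem measurable_volterraKernel (τ t : ℝ) : Measurable (volterraKernel τ t) :=
  Measurable.ite measurableSet_Iio (by fun_prop) measurable_const

theorem intervalIntegrable_abs_sub_rpow_of_le_kernel {q τ : ℝ} (hq : 1 ≤ q) (hτq : q * τ < 1)
    {s t : ℝ} {f g : ℝ → ℝ} (hf : Measurable f) (hg : Measurable g)
    (hf0 : ∀ x, 0 ≤ f x) (hg0 : ∀ x, 0 ≤ g x)
    (hfs : ∀ x, f x ≤ |s - x| ^ (-τ)) (hgt : ∀ x, g x ≤ |t - x| ^ (-τ)) (a b : ℝ) :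
    IntervalIntegrable (fun x => |f x - g x| ^ q) volume a b := by
  refine ((intervalIntegrable_abs_sub_rpow (r := -(q * τ)) (by linarith) s a b).add
    (intervalIntegrable_abs_sub_rpow (r := -(q * τ)) (by linarith) t a b)).mono_fun
    (by have : 0 ≤ q := by linarith
        exact Measurable.aestronglyMeasurable (by fun_prop))
    (Filter.Eventually.of_forall fun x => ?_)
  beta_reduce
  rw [Real.norm_of_nonneg (by positivity), Real.norm_of_nonneg (by positivity)]
  rw [← abs_sub_rpow_neg_rpow, ← abs_sub_rpow_neg_rpow]
  refine (abs_sub_rpow_le_rpow_add_rpow hq (hf0 x) (hg0 x)).trans (add_le_add ?_ ?_)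
  · exact Real.rpow_le_rpow (hf0 x) (hfs x) (by linarith)
  · exact Real.rpow_le_rpow (hg0 x) (hgt x) (by linarith)

/-- The common estimate of both kernels to the left of the two singularities. -/
theorem integral_abs_sub_rpow_left_le {q τ : ℝ} (hq : 1 ≤ q) (hτ : 0 ≤ τ) (hτq : q * τ < 1)
    {a b : ℝ} (ha : 0 ≤ a) (hab : a ≤ b) {F : ℝ → ℝ} (hF : IntervalIntegrable F volume 0 a)
    (hFx : ∀ x < a, F x = |(|a - x| ^ (-τ)) - |b - x| ^ (-τ)| ^ q) :
    ∫ x in (0 : ℝ)..a, F x ≤ (b - a) ^ (1 - q * τ) / (1 - q * τ) := by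
  have hia := intervalIntegrable_abs_sub_rpow (r := -(q * τ)) (by linarith) a 0 a
  have hib := intervalIntegrable_abs_sub_rpow (r := -(q * τ)) (by linarith) b 0 a
  have hp : 0 < 1 - q * τ := by linarith
  calc ∫ x in (0 : ℝ)..a, F x
      ≤ ∫ x in (0 : ℝ)..a, (|a - x| ^ (-(q * τ)) - |b - x| ^ (-(q * τ))) := by
        refine intervalIntegral.integral_mono_on_of_le_Ioo ha hF (hia.sub hib) fun x hx => ?_
        rw [hFx x hx.2, ← abs_sub_rpow_neg_rpow, ← abs_sub_rpow_neg_rpow]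
        refine abs_sub_rpow_le_rpow_sub_rpow hq (by positivity) ?_
        have hax : 0 < a - x := sub_pos.2 hx.2
        rw [abs_of_pos hax, abs_of_pos (by linarith)]
        exact Real.rpow_le_rpow_of_nonpos hax (by linarith) (by linarith)
    _ ≤ _ := by
        rw [intervalIntegral.integral_sub hia hib, integral_abs_sub_rpow_of_le hτq ha le_rfl,
          integral_abs_sub_rpow_of_le hτq ha hab, ← sub_div, sub_self, Real.zero_rpow hp.ne']
        gcongr
        have := Real.rpow_le_rpow (z := 1 - q * τ) ha hab hp.le
        simp only [sub_zero]
        linarith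

theorem integral_abs_sub_rpow_right_le {q τ : ℝ} (hq : 1 ≤ q) (hτ : 0 ≤ τ) (hτq : q * τ < 1)
    {a b : ℝ} (hb : b ≤ 1) (hab : a ≤ b) {F : ℝ → ℝ} (hF : IntervalIntegrable F volume b 1)
    (hFx : ∀ x, b < x → F x = |(|a - x| ^ (-τ)) - |b - x| ^ (-τ)| ^ q) :
    ∫ x in b..1, F x ≤ (b - a) ^ (1 - q * τ) / (1 - q * τ) := by
  have h := integral_abs_sub_rpow_left_le (a := 1 - b) (b := 1 - a) hq hτ hτq (by linarith)
    (by linarith) (F := fun x => F (1 - x)) (by simpa using (hF.comp_sub_left 1).symm) ?_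
  · rw [intervalIntegral.integral_comp_sub_left (fun x => F x) 1] at h
    simpa using h
  · intro x hx
    simp only [hFx (1 - x) (by linarith)]
    rw [abs_sub_comm (_ ^ _), show a - (1 - x) = -(1 - a - x) by ring,
      show b - (1 - x) = -(1 - b - x) by ring, abs_neg, abs_neg]

theorem integral_weaklySingular_le {q τ : ℝ} (hq : 1 ≤ q) (hτ : 0 ≤ τ) (hτq : q * τ < 1)
    {a b : ℝ} (ha : 0 ≤ a) (hab : a ≤ b) (hb : b ≤ 1) :
    ∫ x in (0 : ℝ)..1, |(|a - x| ^ (-τ)) - |b - x| ^ (-τ)| ^ q ≤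
      4 * ((b - a) ^ (1 - q * τ) / (1 - q * τ)) := by
  have hp : 0 < 1 - q * τ := by linarith
  have hF := intervalIntegrable_abs_sub_rpow_of_le_kernel hq hτq (s := a) (t := b)
    (f := fun x => |a - x| ^ (-τ)) (g := fun x => |b - x| ^ (-τ)) (by fun_prop) (by fun_prop)
    (fun x => by positivity) (fun x => by positivity) (fun x => le_rfl) (fun x => le_rfl)
  have hmid : ∫ x in a..b, |(|a - x| ^ (-τ)) - |b - x| ^ (-τ)| ^ q ≤
      2 * ((b - a) ^ (1 - q * τ) / (1 - q * τ)) := by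
    have hia := intervalIntegrable_abs_sub_rpow (r := -(q * τ)) (by linarith) a a b
    have hib := intervalIntegrable_abs_sub_rpow (r := -(q * τ)) (by linarith) b a b
    calc ∫ x in a..b, |(|a - x| ^ (-τ)) - |b - x| ^ (-τ)| ^ q
        ≤ ∫ x in a..b, (|a - x| ^ (-(q * τ)) + |b - x| ^ (-(q * τ))) := by
          refine intervalIntegral.integral_mono_on hab (hF a b) (hia.add hib) fun x _ => ?_
          rw [← abs_sub_rpow_neg_rpow, ← abs_sub_rpow_neg_rpow]
          exact abs_sub_rpow_le_rpow_add_rpow hq (by positivity) (by positivity)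
      _ = _ := by
          rw [intervalIntegral.integral_add hia hib, integral_abs_sub_rpow_of_ge hτq le_rfl hab,
            integral_abs_sub_rpow_of_le hτq hab le_rfl, sub_self, sub_self,
            Real.zero_rpow hp.ne']
          ring
  rw [← intervalIntegral.integral_add_adjacent_intervals (hF 0 a) (hF a 1),
    ← intervalIntegral.integral_add_adjacent_intervals (hF a b) (hF b 1)]
  linarith [integral_abs_sub_rpow_left_le hq hτ hτq ha hab (hF 0 a) fun x _ => rfl,
    integral_abs_sub_rpow_right_le hq hτ hτq hb hab (hF b 1) fun x _ => rfl]

theorem integral_volterra_mem_Icc {q τ : ℝ} (hq : 1 ≤ q) (hτ : 0 ≤ τ) (hτq : q * τ < 1)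
    {a b : ℝ} (ha : 0 ≤ a) (hab : a ≤ b) (hb : b ≤ 1) :
    ∫ x in (0 : ℝ)..1, |volterraKernel τ a x - volterraKernel τ b x| ^ q ∈
      Set.Icc ((b - a) ^ (1 - q * τ) / (1 - q * τ))
        (2 * ((b - a) ^ (1 - q * τ) / (1 - q * τ))) := by
  have hp : 0 < 1 - q * τ := by linarith
  have hF := intervalIntegrable_abs_sub_rpow_of_le_kernel hq hτq (s := a) (t := b)
    (measurable_volterraKernel τ a) (measurable_volterraKernel τ b)
    (volterraKernel_nonneg τ a) (volterraKernel_nonneg τ b)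
    (volterraKernel_le τ a) (volterraKernel_le τ b)
  have hmid : ∫ x in a..b, |volterraKernel τ a x - volterraKernel τ b x| ^ q =
      (b - a) ^ (1 - q * τ) / (1 - q * τ) := by
    calc ∫ x in a..b, |volterraKernel τ a x - volterraKernel τ b x| ^ q
        = ∫ x in a..b, |b - x| ^ (-(q * τ)) := by
          refine intervalIntegral.integral_congr_Ioo_of_le hab fun x hx => ?_
          simp only [volterraKernel_of_le hx.1.le, volterraKernel_of_lt hx.2]
          rw [zero_sub, abs_neg, abs_of_nonneg (by positivity), abs_sub_rpow_neg_rpow]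
      _ = _ := by
          rw [integral_abs_sub_rpow_of_le hτq hab le_rfl, sub_self, Real.zero_rpow hp.ne',
            sub_zero]
  have hright : ∫ x in b..1, |volterraKernel τ a x - volterraKernel τ b x| ^ q = 0 := by
    refine intervalIntegral.integral_zero_ae (Filter.Eventually.of_forall fun x hx => ?_)
    rw [Set.uIoc_of_le hb] at hx
    rw [volterraKernel_of_le (hab.trans hx.1.le), volterraKernel_of_le hx.1.le, sub_self,
      abs_zero, Real.zero_rpow (by linarith)]
  have hleft0 : 0 ≤ ∫ x in (0 : ℝ)..a, |volterraKernel τ a x - volterraKernel τ b x| ^ q :=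
    intervalIntegral.integral_nonneg ha fun x _ => by positivity
  have hleft := integral_abs_sub_rpow_left_le hq hτ hτq ha hab (hF 0 a) fun x hx => by
    rw [volterraKernel_of_lt hx, volterraKernel_of_lt (hx.trans_le hab)]
  rw [← intervalIntegral.integral_add_adjacent_intervals (hF 0 a) (hF a 1),
    ← intervalIntegral.integral_add_adjacent_intervals (hF a b) (hF b 1), hmid, hright]
  constructor <;> linarith

theorem mul_rpow_div_rpow_one_div {q τ C h : ℝ} (hq : 0 < q) (hτq : q * τ < 1) (hC : 0 ≤ C)
    (hh : 0 ≤ h) :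
    (C * (h ^ (1 - q * τ) / (1 - q * τ))) ^ (1 / q) =
      C ^ (1 / q) * (1 - q * τ) ^ (-(1 / q)) * h ^ (1 / q - τ) := by
  have hp : 0 < 1 - q * τ := by linarith
  rw [Real.mul_rpow hC (by positivity), Real.div_rpow (by positivity) hp.le,
    ← Real.rpow_mul hh, show (1 - q * τ) * (1 / q) = 1 / q - τ by field_simp,
    Real.rpow_neg hp.le]
  ring

/-- For `k(x) = x^{-τ}`, `0 < τ < 1/q`, and
`d(s,t) = (∫₀¹ |K(s,x) − K(t,x)|^q dx)^{1/q}`: in the case (WS),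
`d(s,t) ≤ 4^{1/q} (1 − qτ)^{-1/q} |s−t|^{1/q−τ}`; in the case (VO),
`(1 − qτ)^{-1/q} |s−t|^{1/q−τ} ≤ d(s,t) ≤ 2^{1/q} (1 − qτ)^{-1/q} |s−t|^{1/q−τ}`. -/
theorem stmt12 (q τ : ℝ) (hq1 : 1 < q) (hτ0 : 0 < τ) (hτq : τ < 1 / q) :
    (let KWS : ℝ → ℝ → ℝ := fun t x => |t - x| ^ (-τ)
     let d : ℝ → ℝ → ℝ := fun s t => (∫ x in (0:ℝ)..1, |KWS s x - KWS t x| ^ q) ^ (1 / q)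
     ∀ s ∈ Set.Icc (0:ℝ) 1, ∀ t ∈ Set.Icc (0:ℝ) 1,
       d s t ≤ (4:ℝ) ^ (1 / q) * (1 - q * τ) ^ (-(1 / q)) * |s - t| ^ (1 / q - τ)) ∧
    (let KVO : ℝ → ℝ → ℝ := fun t x => if x < t then (t - x) ^ (-τ) else 0
     let d : ℝ → ℝ → ℝ := fun s t => (∫ x in (0:ℝ)..1, |KVO s x - KVO t x| ^ q) ^ (1 / q)
     ∀ s ∈ Set.Icc (0:ℝ) 1, ∀ t ∈ Set.Icc (0:ℝ) 1,
       (1 - q * τ) ^ (-(1 / q)) * |s - t| ^ (1 / q - τ) ≤ d s t ∧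
       d s t ≤ (2:ℝ) ^ (1 / q) * (1 - q * τ) ^ (-(1 / q)) * |s - t| ^ (1 / q - τ)) := by
  have hq0 : 0 < q := by linarith
  have hp : q * τ < 1 := by rwa [lt_div_iff₀ hq0, mul_comm] at hτq
  constructor
  · intro KWS d s hs t ht
    rw [← mul_rpow_div_rpow_one_div hq0 hp (by norm_num) (abs_nonneg (s - t))]
    refine Real.rpow_le_rpow
      (intervalIntegral.integral_nonneg zero_le_one fun x _ => by positivity) ?_ (by positivity)
    rcases le_total s t with h | h
    · rw [abs_sub_comm, abs_of_nonneg (sub_nonneg.2 h)]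
      exact integral_weaklySingular_le hq1.le hτ0.le hp hs.1 h ht.2
    · rw [abs_of_nonneg (sub_nonneg.2 h)]
      simp only [abs_sub_comm (KWS s _)]
      exact integral_weaklySingular_le hq1.le hτ0.le hp ht.1 h hs.2
  · intro KVO d s hs t ht
    have key : ∫ x in (0 : ℝ)..1, |KVO s x - KVO t x| ^ q ∈
        Set.Icc (|s - t| ^ (1 - q * τ) / (1 - q * τ))
          (2 * (|s - t| ^ (1 - q * τ) / (1 - q * τ))) := by
      rcases le_total s t with h | h
      · rw [abs_sub_comm, abs_of_nonneg (sub_nonneg.2 h)]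
        exact integral_volterra_mem_Icc hq1.le hτ0.le hp hs.1 h ht.2
      · rw [abs_of_nonneg (sub_nonneg.2 h)]
        simp only [abs_sub_comm (KVO s _)]
        exact integral_volterra_mem_Icc hq1.le hτ0.le hp ht.1 h hs.2
    have hB : 0 ≤ |s - t| ^ (1 - q * τ) / (1 - q * τ) :=
      div_nonneg (by positivity) (by linarith)
    constructor
    · have h1 := mul_rpow_div_rpow_one_div hq0 hp zero_le_one (abs_nonneg (s - t))
      rw [one_mul, Real.one_rpow, one_mul] at h1
      rw [← h1]
      exact Real.rpow_le_rpow hB key.1 (by positivity)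
    · rw [← mul_rpow_div_rpow_one_div hq0 hp (by norm_num) (abs_nonneg (s - t))]
      exact Real.rpow_le_rpow (hB.trans key.1) key.2 (by positivity)
end
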